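/- arXiv:2307.14048 — 4 statements merged into one kernel-verified Lean document; each statement's English description precedes it below -/
import Mathlib

section
/- For d = 126 and for every integer d ≥ 253, the inequality q_d^{(2)}(n) ≥ Q_d^{(2)}(n) holds for all non-negative integers n, except when d is odd and n equals d+1, d+3, or d+5. -/
/-- `qNum a d n` is the number of partitions of `n` into parts each at least `a`
in which any two parts differ by at least `d`. -/
noncomputable def qNum (a d n : ℕ) : ℕ :=
  Nat.card {p : n.Partition //
    (∀ x ∈ p.parts, a ≤ x) ∧
    p.parts.Pairwise (fun x y => d ≤ max x y - min x y)}

/-- `QNum b d n` is the number of partitions of `n` into parts congruent to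
`b` or `-b` modulo `d + 3`. -/
noncomputable def QNum (b d n : ℕ) : ℕ :=
  Nat.card {p : n.Partition //
    ∀ x ∈ p.parts, x % (d + 3) = b % (d + 3) ∨ (x + b) % (d + 3) = 0}

/-! ### Lower bounds for `qNum` -/

theorem qNum_add_le {a n : ℕ} (d : ℕ) (ha : 0 < a) (hn : a ≤ n) :
    qNum (a + 1) d n + qNum (a + d) d (n - a) ≤ qNum a d n := by
  unfold qNum
  rw [← Nat.card_sum]
  refine Nat.card_le_card_of_injective (Sum.elim
    (fun p => ⟨p.1, fun x hx => (Nat.le_succ a).trans (p.2.1 x hx), p.2.2⟩)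
    (fun p => ⟨⟨a ::ₘ p.1.parts, fun {i} hi => ?_, ?_⟩, fun x hx => ?_, ?_⟩)) ?_
  · rcases Multiset.mem_cons.1 hi with rfl | h
    · exact ha
    · exact p.1.parts_pos h
  · rw [Multiset.sum_cons, p.1.parts_sum]
    omega
  · rcases Multiset.mem_cons.1 hx with rfl | h
    · exact le_rfl
    · exact (Nat.le_add_right a d).trans (p.2.1 x h)
  · obtain ⟨l, hl, hpw⟩ := p.2.2
    refine ⟨a :: l, by simp [hl], List.pairwise_cons.2 ⟨fun y hy => ?_, hpw⟩⟩
    have := p.2.1 y (by rw [hl]; exact hy)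
    omega
  · rintro (⟨p, hp⟩ | ⟨p, hp⟩) (⟨r, hr⟩ | ⟨r, hr⟩) h
    · simpa using h
    · have h' : p.parts = a ::ₘ r.parts := by simpa [Nat.Partition.ext_iff] using h
      have := hp.1 a (by simp [h'])
      omega
    · have h' : a ::ₘ p.parts = r.parts := by simpa [Nat.Partition.ext_iff] using h
      have := hr.1 a (by simp [← h'])
      omega
    · have h' : a ::ₘ p.parts = a ::ₘ r.parts := by simpa [Nat.Partition.ext_iff] using h
      have : p = r := Nat.Partition.ext ((Multiset.cons_inj_right a).1 h')
      subst this
      rfl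

theorem one_le_qNum {a n : ℕ} (d : ℕ) (hn : 0 < n) (h : a ≤ n) : 1 ≤ qNum a d n := by
  unfold qNum
  have : Nonempty {p : n.Partition // (∀ x ∈ p.parts, a ≤ x) ∧
      p.parts.Pairwise (fun x y => d ≤ max x y - min x y)} :=
    ⟨⟨{n}, fun {i} hi => by rw [Multiset.mem_singleton.1 hi]; exact hn, by simp⟩,
      fun x hx => by rw [Multiset.mem_singleton.1 hx]; exact h, [n], rfl, by simp⟩
  exact Nat.card_pos

theorem pow_sub_mul_le_pow {m k : ℕ} (j : ℕ) (h : k ≤ m) :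
    m ^ (j + 1) ≤ (j + 1) * k * m ^ j + (m - k) ^ (j + 1) := by
  induction j with
  | zero => simp; omega
  | succ j ih =>
    obtain ⟨r, rfl⟩ := Nat.exists_eq_add_of_le h
    simp only [Nat.add_sub_cancel_left] at ih ⊢
    have h1 : r ^ (j + 1) ≤ (k + r) ^ (j + 1) := Nat.pow_le_pow_left (by omega) _
    have h2 := Nat.mul_le_mul_left (k + r) ih
    have h3 := Nat.mul_le_mul_left k h1
    calc (k + r) ^ (j + 1 + 1) = (k + r) * (k + r) ^ (j + 1) := by ring
      _ ≤ _ := h2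
      _ = (j + 1) * k * (k + r) ^ (j + 1) + k * r ^ (j + 1) + r ^ (j + 1 + 1) := by ring
      _ ≤ (j + 1) * k * (k + r) ^ (j + 1) + k * (k + r) ^ (j + 1) + r ^ (j + 1 + 1) := by omega
      _ = _ := by ring

/-- Counting the partitions with exactly `k + 1` parts. -/
theorem pow_le_qNum (d k : ℕ) : ∀ m a n : ℕ, 0 < a →
    n = m + (k + 1) * a + d * (k + 1).choose 2 →
    m ^ k ≤ (k + 1).factorial * k.factorial * qNum a d n := by
  induction k with
  | zero =>
    intro m a n ha hn
    have := one_le_qNum (a := a) (n := n) d (by omega) (by omega)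
    simpa using this
  | succ k ih =>
    intro m
    induction m using Nat.strong_induction_on with
    | _ m ihm =>
      intro a n ha hn
      have hc : (k + 1 + 1).choose 2 = (k + 1) + (k + 1).choose 2 := by
        rw [Nat.choose_succ_succ' (k + 1) 1]; simp
      have hexp : n = a + (m + (k + 1) * (a + d) + d * (k + 1).choose 2) := by
        rw [hn, hc]; ring
      have hrec := qNum_add_le (a := a) (n := n) d ha (by omega)
      have h1 := ih m (a + d) (n - a) (by omega) (by omega)
      have h1' : (k + 1) * (k + 2) * m ^ k ≤
          (k + 1 + 1).factorial * (k + 1).factorial * qNum (a + d) d (n - a) := by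
        have := Nat.mul_le_mul_left ((k + 1) * (k + 2)) h1
        refine this.trans (le_of_eq ?_)
        rw [Nat.factorial_succ (k + 1), Nat.factorial_succ k]
        ring
      have h2 : (m - (k + 2)) ^ (k + 1) ≤
          (k + 1 + 1).factorial * (k + 1).factorial * qNum (a + 1) d n := by
        rcases le_or_gt (k + 2) m with hm | hm
        · refine ihm (m - (k + 2)) (by omega) (a + 1) n (by omega) ?_
          obtain ⟨r, rfl⟩ := Nat.exists_eq_add_of_le hm
          rw [hn, Nat.add_sub_cancel_left]; ring
        · rw [Nat.sub_eq_zero_of_le hm.le]; simp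
      have h3 : m ^ (k + 1) ≤ (k + 1) * (k + 2) * m ^ k + (m - (k + 2)) ^ (k + 1) := by
        rcases le_or_gt (k + 2) m with hm | hm
        · exact pow_sub_mul_le_pow k hm
        · rw [pow_succ']
          exact (Nat.mul_le_mul_right _ (hm.le.trans (by nlinarith))).trans
            (Nat.le_add_right _ _)
      calc m ^ (k + 1) ≤ _ := h3
        _ ≤ _ := Nat.add_le_add h1' h2
        _ = (k + 1 + 1).factorial * (k + 1).factorial *
            (qNum (a + 1) d n + qNum (a + d) d (n - a)) := by ring
        _ ≤ _ := Nat.mul_le_mul_left _ hrec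

/-- `pow_le_qNum` for parts at least `2`, with an arbitrary lower bound for the excess. -/
theorem pow_le_qNum_two {d k m n : ℕ} (h : m + (k + 1) * 2 + d * (k + 1).choose 2 ≤ n) :
    m ^ k ≤ (k + 1).factorial * k.factorial * qNum 2 d n := by
  obtain ⟨r, rfl⟩ := Nat.exists_eq_add_of_le h
  exact (Nat.pow_le_pow_left (Nat.le_add_right m r) k).trans
    (pow_le_qNum d k (m + r) 2 _ two_pos (by ring))

/-! ### Partitions with parts in a set -/

/-- The number of partitions of `n` with all parts in `S`. -/
noncomputable def partsInCard (S : Set ℕ) (n : ℕ) : ℕ :=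
  Nat.card {p : n.Partition // ∀ x ∈ p.parts, x ∈ S}

theorem card_le_partsInCard {n : ℕ} {P : ℕ → Prop} {S : Set ℕ}
    (h : ∀ x, 0 < x → x ≤ n → P x → x ∈ S) :
    Nat.card {p : n.Partition // ∀ x ∈ p.parts, P x} ≤ partsInCard S n := by
  refine Nat.card_le_card_of_injective
    (fun p => ⟨p.1, fun x hx => h x (p.1.parts_pos hx) ?_ (p.2 x hx)⟩) ?_
  · exact (Multiset.le_sum_of_mem hx).trans p.1.parts_sum.le
  · intro p r hpr
    exact Subtype.ext (by simpa using hpr)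

theorem partsInCard_insert_of_lt {S : Set ℕ} {y n : ℕ} (h : n < y) :
    partsInCard (insert y S) n ≤ partsInCard S n :=
  card_le_partsInCard fun x _ hx hxS => hxS.resolve_left (by omega)

theorem partsInCard_insert_le {S : Set ℕ} {y n : ℕ} (h : y ≤ n) :
    partsInCard (insert y S) n ≤ partsInCard S n + partsInCard (insert y S) (n - y) := by
  classical
  unfold partsInCard
  rw [← Nat.card_sum]
  refine Nat.card_le_card_of_injective (fun p =>
    if hy : y ∈ p.1.parts then
      Sum.inr ⟨⟨p.1.parts.erase y, fun {i} hi => p.1.parts_pos (Multiset.mem_of_mem_erase hi), ?_⟩,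
        fun x hx => p.2 x (Multiset.mem_of_mem_erase hx)⟩
    else Sum.inl ⟨p.1, fun x hx => (p.2 x hx).resolve_left fun hxy => hy (hxy ▸ hx)⟩) ?_
  · have := Multiset.sum_erase hy
    rw [p.1.parts_sum] at this
    omega
  · intro p r hpr
    by_cases hp : y ∈ p.1.parts <;> by_cases hr : y ∈ r.1.parts <;>
      simp only [hp, hr, dite_true, dite_false, reduceCtorEq] at hpr
    · have h' : p.1.parts.erase y = r.1.parts.erase y := by
        simpa [Nat.Partition.ext_iff] using hpr
      refine Subtype.ext (Nat.Partition.ext ?_)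
      rw [← Multiset.cons_erase hp, h', Multiset.cons_erase hr]
    · exact Subtype.ext (by simpa using hpr)

theorem parts_eq_replicate_of_forall_eq_two {n : ℕ} {p : n.Partition}
    (hp : ∀ x ∈ p.parts, x ∈ ({2} : Set ℕ)) :
    p.parts = Multiset.replicate p.parts.card 2 ∧ 2 * p.parts.card = n := by
  have h := Multiset.eq_replicate_card.2 hp
  refine ⟨h, ?_⟩
  have := p.parts_sum
  rw [h, Multiset.sum_replicate, smul_eq_mul] at this
  omega

theorem partsInCard_two_le_one (n : ℕ) : partsInCard {2} n ≤ 1 := by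
  refine Finite.card_le_one_iff_subsingleton.2 ⟨fun p r => ?_⟩
  obtain ⟨hp, hp'⟩ := parts_eq_replicate_of_forall_eq_two p.2
  obtain ⟨hr, hr'⟩ := parts_eq_replicate_of_forall_eq_two r.2
  refine Subtype.ext (Nat.Partition.ext ?_)
  rw [hp, hr, show p.1.parts.card = r.1.parts.card by omega]

theorem partsInCard_two_of_odd {n : ℕ} (hn : n % 2 = 1) : partsInCard {2} n = 0 := by
  have : IsEmpty {p : n.Partition // ∀ x ∈ p.parts, x ∈ ({2} : Set ℕ)} :=
    ⟨fun p => by have := (parts_eq_replicate_of_forall_eq_two p.2).2; omega⟩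
  exact Nat.card_of_isEmpty

/-- Adjoining a part of weight at least `k` multiplies an exponential bound by `(1 - z ^ k)⁻¹`. -/
theorem partsInCard_insert_le_of_forall_le {S : Set ℕ} {D y k : ℕ} {A z : ℝ} (hz : 0 < z)
    (hz1 : z < 1) (hD : 0 < D) (hk : 0 < k) (hy : k * D ≤ y) (hA : 0 ≤ A)
    (hS : ∀ n, (partsInCard S n : ℝ) ≤ A * z⁻¹ ^ (n / D)) (n : ℕ) :
    (partsInCard (insert y S) n : ℝ) ≤ A * (1 - z ^ k)⁻¹ * z⁻¹ ^ (n / D) := by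
  have hzk : z ^ k < 1 := pow_lt_one₀ hz.le hz1 hk.ne'
  have hB : A * (1 - z ^ k)⁻¹ * (1 - z ^ k) = A := by
    rw [mul_assoc, inv_mul_cancel₀ (by linarith), mul_one]
  set B := A * (1 - z ^ k)⁻¹ with hBdef
  have hB0 : 0 ≤ B := mul_nonneg hA (inv_nonneg.2 (by linarith))
  induction n using Nat.strong_induction_on with
  | _ n ih =>
    have hp : 0 < z⁻¹ ^ (n / D) := by positivity
    rcases le_or_gt y n with hyn | hyn
    · have hy0 : 0 < y := lt_of_lt_of_le (Nat.mul_pos hk hD) hy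
      have h1 : (partsInCard (insert y S) n : ℝ) ≤
          partsInCard S n + partsInCard (insert y S) (n - y) := by
        exact_mod_cast partsInCard_insert_le hyn
      have h2 := ih (n - y) (by omega)
      have h3 : (n - y) / D + k ≤ n / D := by
        rw [← Nat.add_mul_div_right _ _ hD]
        exact Nat.div_le_div_right (by omega)
      have h4 : z⁻¹ ^ ((n - y) / D) ≤ z⁻¹ ^ (n / D) * z ^ k := by
        have : z⁻¹ ^ ((n - y) / D) = z⁻¹ ^ ((n - y) / D + k) * z ^ k := by
          rw [pow_add, mul_assoc, ← mul_pow, inv_mul_cancel₀ hz.ne', one_pow, mul_one]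
        rw [this]
        exact mul_le_mul_of_nonneg_right
          (pow_le_pow_right₀ (one_le_inv_iff₀.2 ⟨hz, hz1.le⟩) h3) (by positivity)
      calc (partsInCard (insert y S) n : ℝ) ≤ _ := h1
        _ ≤ A * z⁻¹ ^ (n / D) + B * (z⁻¹ ^ (n / D) * z ^ k) :=
          add_le_add (hS n) (h2.trans (mul_le_mul_of_nonneg_left h4 hB0))
        _ = (B * (1 - z ^ k)) * z⁻¹ ^ (n / D) + B * (z⁻¹ ^ (n / D) * z ^ k) := by rw [hB]
        _ = _ := by ring
    · have h1 : (partsInCard (insert y S) n : ℝ) ≤ partsInCard S n := by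
        exact_mod_cast partsInCard_insert_of_lt hyn
      have h2 : A ≤ B := by
        rw [← hB]
        exact mul_le_of_le_one_right hB0 (by have := pow_pos hz k; linarith)
      exact (h1.trans (hS n)).trans (mul_le_mul_of_nonneg_right h2 hp.le)

/-! ### Upper bounds for `QNum` -/

/-- The positive integers congruent to `2` or `-2` modulo `d + 3`, up to `K * (d + 3) + 2`. -/
def levelTwoParts (d : ℕ) : ℕ → Set ℕ
  | 0 => {2}
  | K + 1 => insert ((K + 1) * (d + 3) - 2) (insert ((K + 1) * (d + 3) + 2) (levelTwoParts d K))

theorem mem_levelTwoParts {d k K x : ℕ} (hk : k ≤ K)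
    (hx : 0 < k ∧ x = k * (d + 3) - 2 ∨ x = k * (d + 3) + 2) : x ∈ levelTwoParts d K := by
  induction K with
  | zero =>
    obtain rfl : k = 0 := by omega
    simpa [levelTwoParts] using hx
  | succ K ih =>
    rcases Nat.lt_or_ge K k with h | h
    · obtain rfl : k = K + 1 := by omega
      rcases hx with hx | hx
      · exact Or.inl hx.2
      · exact Or.inr (Or.inl hx)
    · exact Or.inr (Or.inr (ih h))

theorem QNum_two_le_partsInCard (d n : ℕ) :
    QNum 2 d n ≤ partsInCard (levelTwoParts d (n / (d + 1))) n := by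
  refine card_le_partsInCard fun x hx0 hxn hx => ?_
  rcases hx with hx | hx
  · have h := Nat.div_add_mod x (d + 3)
    rw [hx] at h
    rcases Nat.eq_zero_or_pos d with rfl | hd
    · refine mem_levelTwoParts (k := x / 3) ?_ (Or.inr ?_) <;> omega
    rw [Nat.mod_eq_of_lt (by omega : 2 < d + 3)] at h
    refine mem_levelTwoParts (k := x / (d + 3)) ?_ (Or.inr (by rw [mul_comm]; exact h.symm))
    exact (Nat.div_le_div_left (by omega) (by omega)).trans (Nat.div_le_div_right hxn)
  · have h := Nat.div_add_mod (x + 2) (d + 3)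
    rw [hx, add_zero, mul_comm] at h
    have hk : 0 < (x + 2) / (d + 3) := by
      by_contra h0
      rw [Nat.eq_zero_of_not_pos h0] at h
      omega
    refine mem_levelTwoParts (k := (x + 2) / (d + 3)) ?_ (Or.inl ⟨hk, by omega⟩)
    rw [Nat.le_div_iff_mul_le (by omega)]
    nlinarith

theorem partsInCard_levelTwoParts_le (d K n : ℕ) {z : ℝ} (hz : 0 < z) (hz1 : z < 1) :
    (partsInCard (levelTwoParts d K) n : ℝ) ≤
      (∏ i ∈ Finset.range K, (1 - z ^ (i + 1)))⁻¹ ^ 2 * z⁻¹ ^ (n / (d + 1)) := by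
  have hz' : 1 ≤ z⁻¹ := one_le_inv_iff₀.2 ⟨hz, hz1.le⟩
  induction K generalizing n with
  | zero =>
    have : (partsInCard {2} n : ℝ) ≤ 1 := by exact_mod_cast partsInCard_two_le_one n
    simpa [levelTwoParts] using this.trans (one_le_pow₀ hz')
  | succ K ih =>
    have hw : (K + 1) * (d + 1) + 2 ≤ (K + 1) * (d + 3) := by nlinarith
    have h0 : 0 ≤ (1 - z ^ (K + 1))⁻¹ :=
      inv_nonneg.2 (sub_nonneg.2 (pow_le_one₀ hz.le hz1.le))
    have h1 := partsInCard_insert_le_of_forall_le hz hz1 (Nat.succ_pos d) (Nat.succ_pos K)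
      (y := (K + 1) * (d + 3) + 2) (by rw [Nat.succ_eq_add_one, Nat.succ_eq_add_one]; omega)
      (by positivity) ih
    have h2 := partsInCard_insert_le_of_forall_le hz hz1 (Nat.succ_pos d) (Nat.succ_pos K)
      (y := (K + 1) * (d + 3) - 2) (by rw [Nat.succ_eq_add_one, Nat.succ_eq_add_one]; omega)
      (mul_nonneg (by positivity) h0) h1 n
    refine h2.trans (le_of_eq ?_)
    rw [Finset.prod_range_succ, mul_inv]
    simp only [Nat.succ_eq_add_one]
    ring

theorem QNum_two_le (d n : ℕ) {z : ℝ} (hz : 0 < z) (hz1 : z < 1) :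
    (QNum 2 d n : ℝ) ≤
      (∏ i ∈ Finset.range (n / (d + 1)), (1 - z ^ (i + 1)))⁻¹ ^ 2 * z⁻¹ ^ (n / (d + 1)) :=
  (Nat.cast_le.2 (QNum_two_le_partsInCard d n)).trans
    (partsInCard_levelTwoParts_le d _ n hz hz1)

theorem le_prod_one_sub_half_pow (K : ℕ) :
    (0.2887 : ℝ) ≤ ∏ i ∈ Finset.range K, (1 - (1 / 2 : ℝ) ^ (i + 1)) := by
  have key : ∀ r : ℕ, (∏ i ∈ Finset.range 12, (1 - (1 / 2 : ℝ) ^ (i + 1))) *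
      (1 - (1 / 2) ^ 12 + (1 / 2) ^ (12 + r)) ≤
      ∏ i ∈ Finset.range (12 + r), (1 - (1 / 2 : ℝ) ^ (i + 1)) := by
    intro r
    induction r with
    | zero => simp
    | succ r ih =>
      have hb : (1 / 2 : ℝ) ^ (12 + r) ≤ (1 / 2) ^ 12 :=
        pow_le_pow_of_le_one (by norm_num) (by norm_num) (by omega)
      have hb0 : (0 : ℝ) < (1 / 2) ^ (12 + r) := by positivity
      have hc : (0 : ℝ) ≤ ∏ i ∈ Finset.range 12, (1 - (1 / 2 : ℝ) ^ (i + 1)) :=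
        Finset.prod_nonneg fun i _ => sub_nonneg.2 (pow_le_one₀ (by norm_num) (by norm_num))
      have hf : (0 : ℝ) ≤ 1 - (1 / 2) ^ (12 + r + 1) :=
        sub_nonneg.2 (pow_le_one₀ (by norm_num) (by norm_num))
      rw [← add_assoc, Finset.prod_range_succ _ (12 + r)]
      refine le_trans ?_ (mul_le_mul_of_nonneg_right ih hf)
      rw [mul_assoc, pow_succ (1 / 2 : ℝ) (12 + r)]
      exact mul_le_mul_of_nonneg_left (by nlinarith) hc
  have h12 : (0.2887 : ℝ) ≤ (∏ i ∈ Finset.range 12, (1 - (1 / 2 : ℝ) ^ (i + 1))) *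
      (1 - (1 / 2) ^ 12) := by
    norm_num [Finset.prod_range_succ]
  have hmono : Antitone fun K : ℕ => ∏ i ∈ Finset.range K, (1 - (1 / 2 : ℝ) ^ (i + 1)) := by
    refine antitone_nat_of_succ_le fun K => ?_
    rw [Finset.prod_range_succ]
    refine mul_le_of_le_one_right
      (Finset.prod_nonneg fun i _ => sub_nonneg.2 (pow_le_one₀ (by norm_num) (by norm_num))) ?_
    have : (0 : ℝ) < (1 / 2) ^ (K + 1) := by positivity
    linarith
  refine le_trans ?_ ((key K).trans (hmono (Nat.le_add_left K 12)))
  refine h12.trans (mul_le_mul_of_nonneg_left ?_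
    (Finset.prod_nonneg fun i _ => sub_nonneg.2 (pow_le_one₀ (by norm_num) (by norm_num))))
  have : (0 : ℝ) < (1 / 2) ^ (12 + K) := by positivity
  linarith

theorem QNum_two_le_two_pow (d n : ℕ) : QNum 2 d n ≤ 12 * 2 ^ (n / (d + 1)) := by
  have h := QNum_two_le d n (z := 1 / 2) (by norm_num) (by norm_num)
  have hp := le_prod_one_sub_half_pow (n / (d + 1))
  have h2 : (∏ i ∈ Finset.range (n / (d + 1)), (1 - (1 / 2 : ℝ) ^ (i + 1)))⁻¹ ^ 2 ≤ 12 := by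
    calc _ ≤ (0.2887 : ℝ)⁻¹ ^ 2 := by gcongr
      _ ≤ 12 := by norm_num
  have h3 := h.trans (mul_le_mul_of_nonneg_right h2 (by positivity))
  rw [one_div, inv_inv] at h3
  exact_mod_cast h3

theorem pow_succ_div_one_sub_pow_le {t : ℝ} (ht : 0 < t) (m : ℕ) :
    (t / (t + 1)) ^ (m + 1) / (1 - (t / (t + 1)) ^ (m + 1)) ≤ t / (m + 1) := by
  set z := t / (t + 1) with hzdef
  have hz : 0 < z := by positivity
  have hz1 : z < 1 := by rw [hzdef, div_lt_one (by positivity)]; linarith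
  have hzm : z ^ (m + 1) < 1 := pow_lt_one₀ hz.le hz1 (by omega)
  have htz : z = t * (1 - z) := by rw [hzdef]; field_simp; ring
  have hgeom : (1 - z) * ((m + 1) * z ^ m) ≤ 1 - z ^ (m + 1) := by
    rw [← mul_neg_geom_sum z (m + 1)]
    refine mul_le_mul_of_nonneg_left ?_ (by linarith)
    calc ((m : ℝ) + 1) * z ^ m = ∑ _i ∈ Finset.range (m + 1), z ^ m := by simp
      _ ≤ _ := Finset.sum_le_sum fun i hi => pow_le_pow_of_le_one hz.le hz1.le
        (by have := Finset.mem_range.1 hi; omega)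
  rw [div_le_div_iff₀ (by linarith) (by positivity)]
  calc z ^ (m + 1) * (m + 1) = z * ((m + 1) * z ^ m) := by ring
    _ = t * ((1 - z) * ((m + 1) * z ^ m)) := by rw [← mul_assoc t, ← htz]
    _ ≤ _ := mul_le_mul_of_nonneg_left hgeom ht.le

theorem inv_prod_one_sub_pow_le_exp {t : ℝ} (ht : 0 < t) (K : ℕ) :
    (∏ i ∈ Finset.range K, (1 - (t / (t + 1)) ^ (i + 1)))⁻¹ ≤
      Real.exp (t * (Real.pi ^ 2 / 6)) := by
  have hz : 0 < t / (t + 1) := by positivity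
  have hz1 : t / (t + 1) < 1 := by rw [div_lt_one (by positivity)]; linarith
  have hbound := pow_succ_div_one_sub_pow_le ht
  set z := t / (t + 1)
  have hzi : ∀ i : ℕ, z ^ (i + 1) < 1 := fun i => pow_lt_one₀ hz.le hz1 (by omega)
  have hpos : 0 < ∏ i ∈ Finset.range K, (1 - z ^ (i + 1)) :=
    Finset.prod_pos fun i _ => sub_pos.2 (hzi i)
  have h1 : HasSum (fun m : ℕ => ∑ i ∈ Finset.range K, (z ^ (i + 1)) ^ (m + 1) / (m + 1))
      (∑ i ∈ Finset.range K, -Real.log (1 - z ^ (i + 1))) :=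
    hasSum_sum fun i _ => Real.hasSum_pow_div_log_of_abs_lt_one
      (by rw [abs_of_pos (by positivity)]; exact hzi i)
  have h2 : HasSum (fun m : ℕ => t * (1 / ((m + 1 : ℕ) : ℝ) ^ 2)) (t * (Real.pi ^ 2 / 6)) := by
    have := (hasSum_nat_add_iff' 1).2 hasSum_zeta_two
    simpa using this.mul_left t
  have h3 : ∑ i ∈ Finset.range K, -Real.log (1 - z ^ (i + 1)) ≤ t * (Real.pi ^ 2 / 6) := by
    refine hasSum_le (fun m => ?_) h1 h2
    have hgeom : ∑ i ∈ Finset.range K, (z ^ (i + 1)) ^ (m + 1) ≤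
        z ^ (m + 1) / (1 - z ^ (m + 1)) := by
      have hs : ∑ i ∈ Finset.range K, (z ^ (i + 1)) ^ (m + 1) =
          z ^ (m + 1) * ∑ i ∈ Finset.range K, (z ^ (m + 1)) ^ i := by
        rw [Finset.mul_sum]
        exact Finset.sum_congr rfl fun i _ => by ring
      rw [hs, div_eq_mul_inv, ← tsum_geometric_of_lt_one (by positivity) (hzi m)]
      exact mul_le_mul_of_nonneg_left
        ((summable_geometric_of_lt_one (by positivity) (hzi m)).sum_le_tsum _
          fun i _ => by positivity) (by positivity)
    rw [← Finset.sum_div]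
    calc (∑ i ∈ Finset.range K, (z ^ (i + 1)) ^ (m + 1)) / (m + 1 : ℝ)
        ≤ (t / (m + 1)) / (m + 1) := by gcongr; exact hgeom.trans (hbound m)
      _ = _ := by push_cast; field_simp
  rw [← Real.exp_log (inv_pos.2 hpos), Real.exp_le_exp, Real.log_inv,
    Real.log_prod fun i _ => (sub_pos.2 (hzi i)).ne', ← Finset.sum_neg_distrib]
  exact h3

theorem QNum_two_le_exp (d n : ℕ) {t : ℝ} (ht : 0 < t) :
    (QNum 2 d n : ℝ) ≤ Real.exp ((n / (d + 1) : ℕ) / t + 4 * t) := by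
  have hz : 0 < t / (t + 1) := by positivity
  have hz1 : t / (t + 1) < 1 := by rw [div_lt_one (by positivity)]; linarith
  refine (QNum_two_le d n hz hz1).trans ?_
  have h1 := inv_prod_one_sub_pow_le_exp ht (n / (d + 1))
  have h0 : 0 ≤ (∏ i ∈ Finset.range (n / (d + 1)), (1 - (t / (t + 1)) ^ (i + 1)))⁻¹ :=
    inv_nonneg.2 (Finset.prod_nonneg fun i _ => sub_nonneg.2 (pow_le_one₀ hz.le hz1.le))
  have h2 : (t / (t + 1))⁻¹ ≤ Real.exp (1 / t) := by
    have : (t / (t + 1))⁻¹ = 1 / t + 1 := by field_simp; ring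
    rw [this]
    exact Real.add_one_le_exp _
  have hpi : Real.pi ^ 2 / 6 ≤ 2 := by
    have h3 := Real.pi_lt_d2
    have h4 := Real.pi_pos
    nlinarith
  calc _ ≤ Real.exp (t * (Real.pi ^ 2 / 6)) ^ 2 * Real.exp (1 / t) ^ (n / (d + 1)) := by
        gcongr
    _ = Real.exp ((n / (d + 1) : ℕ) * (1 / t) + 2 * (t * (Real.pi ^ 2 / 6))) := by
        rw [Real.exp_add, Real.exp_nat_mul, mul_comm]
        congr 1
        exact (Real.exp_nat_mul _ 2).symm
    _ ≤ _ := by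
        rw [Real.exp_le_exp]
        have := mul_le_mul_of_nonneg_left hpi ht.le
        rw [mul_one_div]
        linarith

/-! ### Comparison -/

theorem QNum_le_of_lt {d n : ℕ} (hn : n < d + 1) : QNum 2 d n ≤ qNum 2 d n := by
  have hQ := QNum_two_le_partsInCard d n
  rw [Nat.div_eq_of_lt hn, levelTwoParts] at hQ
  rcases Nat.eq_zero_or_pos n with rfl | h0
  · refine (hQ.trans (partsInCard_two_le_one 0)).trans ?_
    unfold qNum
    have : Nonempty {p : Nat.Partition 0 // (∀ x ∈ p.parts, 2 ≤ x) ∧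
        p.parts.Pairwise (fun x y => d ≤ max x y - min x y)} :=
      ⟨⟨0, by simp, by simp⟩, by simp, [], rfl, by simp⟩
    exact Nat.card_pos
  rcases Nat.lt_or_ge n 2 with h2 | h2
  · rw [partsInCard_two_of_odd (by omega)] at hQ
    omega
  · exact (hQ.trans (partsInCard_two_le_one n)).trans (one_le_qNum d h0 h2)

theorem QNum_le_of_lt_two_mul {d n : ℕ} (hd : 3 ≤ d) (hn : d + 1 ≤ n) (hn' : n < 2 * (d + 1))
    (hexc : ¬ (Odd d ∧ (n = d + 1 ∨ n = d + 3 ∨ n = d + 5))) :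
    QNum 2 d n ≤ qNum 2 d n := by
  have hQ := QNum_two_le_partsInCard d n
  rw [Nat.div_eq_of_lt_le (by omega : 1 * (d + 1) ≤ n) (by omega)] at hQ
  have hset : levelTwoParts d 1 = insert (d + 1) (insert (d + 5) {2}) := by
    simp [levelTwoParts]
  rw [hset] at hQ
  have hstep := partsInCard_insert_le (S := insert (d + 5) {2}) hn
  have hrest : partsInCard (insert (d + 1) (insert (d + 5) {2})) (n - (d + 1)) ≤
      partsInCard {2} (n - (d + 1)) :=
    (partsInCard_insert_of_lt (by omega)).trans (partsInCard_insert_of_lt (by omega))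
  have hone := partsInCard_two_le_one
  have hq1 := one_le_qNum (a := 2) (n := n) d (by omega) (by omega)
  have a1 := hone n
  have a2 := hone (n - (d + 1))
  have a3 := hone (n - (d + 5))
  have b1 := fun h => partsInCard_two_of_odd (n := n) h
  have b2 := fun h => partsInCard_two_of_odd (n := n - (d + 1)) h
  rw [Nat.odd_iff] at hexc
  rcases Nat.lt_or_ge n (d + 5) with h5 | h5
  · have h := partsInCard_insert_of_lt (S := {2}) h5
    omega
  · have h := partsInCard_insert_le (S := {2}) h5
    have h' : partsInCard (insert (d + 5) {2}) (n - (d + 5)) ≤ partsInCard {2} (n - (d + 5)) :=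
      partsInCard_insert_of_lt (by omega)
    have hq2 := qNum_add_le (a := 2) (n := n) d two_pos (by omega)
    have hq3 := qNum_add_le (a := 3) (n := n) d three_pos (by omega)
    have c1 := one_le_qNum (a := 2 + d) (n := n - 2) d (by omega) (by omega)
    have c2 := one_le_qNum (a := 4) (n := n) d (by omega) (by omega)
    have b3 := fun h => partsInCard_two_of_odd (n := n - (d + 5)) h
    norm_num at hq2 hq3
    rcases Nat.lt_or_ge n (d + 6) with h6 | h6
    · omega
    · have c3 := one_le_qNum (a := 3 + d) (n := n - 3) d (by omega) (by omega)
      omega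

theorem QNum_le_of_pow {d n k m C : ℕ} (h : m + (k + 1) * 2 + d * (k + 1).choose 2 ≤ n)
    (hQ : QNum 2 d n ≤ C) (hC : (k + 1).factorial * k.factorial * C ≤ m ^ k) :
    QNum 2 d n ≤ qNum 2 d n :=
  hQ.trans (Nat.le_of_mul_le_mul_left (hC.trans (pow_le_qNum_two h)) (by positivity))

theorem QNum_le_of_div_lt {d n : ℕ} (hd : 126 ≤ d) (h2 : 2 ≤ n / (d + 1))
    (h30 : n / (d + 1) < 30) : QNum 2 d n ≤ qNum 2 d n := by
  have hQ := QNum_two_le_two_pow d n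
  have hJ : n / (d + 1) * (d + 1) ≤ n := Nat.div_mul_le_self n (d + 1)
  generalize n / (d + 1) = J at *
  have hpow : ∀ K, J ≤ K → QNum 2 d n ≤ 12 * 2 ^ K := fun K hK =>
    hQ.trans (Nat.mul_le_mul_left _ (Nat.pow_le_pow_right two_pos hK))
  have hmul : ∀ K, K ≤ J → K * (d + 1) ≤ n := fun K hK =>
    (Nat.mul_le_mul_right _ hK).trans hJ
  have main : ∀ k m lo hi : ℕ, lo ≤ J → J ≤ hi →
      m + (k + 1) * 2 + d * (k + 1).choose 2 ≤ lo * (d + 1) →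
      (k + 1).factorial * k.factorial * (12 * 2 ^ hi) ≤ m ^ k → QNum 2 d n ≤ qNum 2 d n :=
    fun k m lo hi h1 h3 h4 h5 => QNum_le_of_pow (h4.trans (hmul lo h1)) (hpow hi h3) h5
  rcases Nat.lt_or_ge J 3 with h | h
  · exact main 1 124 2 2 h2 (by omega) (by norm_num [Nat.choose]; omega) (by decide)
  rcases Nat.lt_or_ge J 4 with h' | h'
  · exact main 1 251 3 3 h (by omega) (by norm_num [Nat.choose]; omega) (by decide)
  rcases Nat.lt_or_ge J 7 with h | h
  · exact main 2 124 4 6 h' (by omega) (by norm_num [Nat.choose]; omega) (by decide)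
  rcases Nat.lt_or_ge J 11 with h' | h'
  · exact main 2 505 7 10 h (by omega) (by norm_num [Nat.choose]; omega) (by decide)
  rcases Nat.lt_or_ge J 18 with h | h
  · exact main 3 633 11 17 h' (by omega) (by norm_num [Nat.choose]; omega) (by decide)
  rcases Nat.lt_or_ge J 25 with h' | h'
  · exact main 4 1016 18 24 h (by omega) (by norm_num [Nat.choose]; omega) (by decide)
  · exact main 5 1273 25 29 h' (by omega) (by norm_num [Nat.choose]; omega) (by decide)

theorem factorial_mul_exp_le_pow (k : ℕ) (hk : 5 ≤ k) :
    (k + 1).factorial * k.factorial * Real.exp (4 * (k + 1 : ℕ) + 2) ≤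
      ((63 * (k * (k + 1)) : ℕ) : ℝ) ^ k := by
  have he : Real.exp 1 ≤ 2.7183 := Real.exp_one_lt_d9.le.trans (by norm_num)
  have hnat : ∀ j : ℕ, Real.exp j ≤ 2.7183 ^ j := fun j => by
    rw [← Real.exp_one_pow]; gcongr
  induction k, hk using Nat.le_induction with
  | base =>
    have h := hnat 26
    have h' : Real.exp (4 * (5 + 1 : ℕ) + 2) ≤ 2.7183 ^ 26 := by
      refine le_trans (le_of_eq ?_) h
      norm_num
    calc _ ≤ ((5 + 1).factorial * Nat.factorial 5 : ℝ) * 2.7183 ^ 26 := by gcongr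
      _ ≤ _ := by norm_num [Nat.factorial]
  | succ k hk ih =>
    have h4 : Real.exp 4 ≤ 63 := by
      have := hnat 4
      norm_num at this ⊢
      linarith
    have hexp : Real.exp (4 * (k + 1 + 1 : ℕ) + 2) =
        Real.exp 4 * Real.exp (4 * (k + 1 : ℕ) + 2) := by
      rw [← Real.exp_add]; congr 1; push_cast; ring
    have hfac : ((k + 1 + 1).factorial * (k + 1).factorial : ℝ) =
        ((k + 1) * (k + 2)) * ((k + 1).factorial * k.factorial) := by
      rw [Nat.factorial_succ (k + 1), Nat.factorial_succ k]
      push_cast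
      ring
    rw [hexp, hfac]
    calc ((k + 1 : ℝ) * (k + 2)) * ((k + 1).factorial * k.factorial) *
          (Real.exp 4 * Real.exp (4 * (k + 1 : ℕ) + 2))
        = ((k + 1 : ℝ) * (k + 2)) * Real.exp 4 *
          ((k + 1).factorial * k.factorial * Real.exp (4 * (k + 1 : ℕ) + 2)) := by ring
      _ ≤ ((k + 1 : ℝ) * (k + 2)) * 63 * ((63 * (k * (k + 1)) : ℕ) : ℝ) ^ k := by gcongr
      _ ≤ ((k + 1 : ℝ) * (k + 2)) * 63 * ((63 * ((k + 1) * (k + 1 + 1)) : ℕ) : ℝ) ^ k := by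
          gcongr <;> omega
      _ = _ := by rw [pow_succ]; push_cast; ring

theorem QNum_le_of_le_div {d n : ℕ} (hd : 126 ≤ d) (h30 : 30 ≤ n / (d + 1)) :
    QNum 2 d n ≤ qNum 2 d n := by
  have hexp := fun t ht => QNum_two_le_exp d n (t := t) ht
  have hJ : n / (d + 1) * (d + 1) ≤ n := Nat.div_mul_le_self n (d + 1)
  generalize n / (d + 1) = J at *
  obtain ⟨k, hk1, hk2⟩ : ∃ k, k * (k + 1) ≤ J ∧ J < (k + 1) * (k + 2) := by
    have hex : ∃ k, J < (k + 1) * (k + 2) := ⟨J, by nlinarith⟩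
    refine ⟨Nat.find hex, ?_, Nat.find_spec hex⟩
    rcases h : Nat.find hex with _ | k
    · simp
    · exact not_lt.1 (Nat.find_min hex (h ▸ Nat.lt_succ_self k))
  have hk : 5 ≤ k := by nlinarith
  have hQ : (QNum 2 d n : ℝ) ≤ Real.exp (4 * (k + 1 : ℕ) + 2) := by
    refine (hexp ((k + 1) / 2) (by positivity)).trans (Real.exp_le_exp.2 ?_)
    have h1 : (J : ℝ) ≤ (k + 1) * (k + 2) := by exact_mod_cast hk2.le
    have h2 : (J : ℝ) / ((k + 1) / 2) ≤ 2 * (k + 2) := by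
      rw [div_le_iff₀ (by positivity)]
      linarith
    push_cast
    linarith
  have hm : 63 * (k * (k + 1)) + (k + 1) * 2 + d * (k + 1).choose 2 ≤ n := by
    have hch : (k + 1).choose 2 * 2 = k * (k + 1) := by
      rw [Nat.choose_two_right, Nat.add_sub_cancel, Nat.div_mul_cancel, mul_comm]
      exact (Nat.even_mul_succ_self k |>.two_dvd) |> fun h => by rwa [mul_comm]
    have h1 := (Nat.mul_le_mul_right (d + 1) hk1).trans hJ
    have h2 : 126 * (k + 1).choose 2 ≤ d * (k + 1).choose 2 := Nat.mul_le_mul_right _ hd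
    have h3 : (k + 1) * 2 ≤ k * (k + 1) := by nlinarith
    have h4 : k * (k + 1) * (d + 1) = 2 * (d * (k + 1).choose 2) + k * (k + 1) := by
      rw [← hch]; ring
    omega
  have hq : (((63 * (k * (k + 1)) : ℕ) : ℝ)) ^ k ≤
      (k + 1).factorial * k.factorial * (qNum 2 d n : ℝ) := by
    exact_mod_cast pow_le_qNum_two hm
  have hfin := (factorial_mul_exp_le_pow k hk).trans hq
  have hpos : (0 : ℝ) < (k + 1).factorial * k.factorial := by positivity
  exact_mod_cast hQ.trans (le_of_mul_le_mul_left hfin hpos)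

theorem alder_level_two (d n : ℕ) (hd : d = 126 ∨ 253 ≤ d)
    (hn : ¬ (Odd d ∧ (n = d + 1 ∨ n = d + 3 ∨ n = d + 5))) :
    QNum 2 d n ≤ qNum 2 d n := by
  have hd' : 126 ≤ d := by omega
  rcases Nat.lt_or_ge n (d + 1) with h1 | h1
  · exact QNum_le_of_lt h1
  rcases Nat.lt_or_ge n (2 * (d + 1)) with h2 | h2
  · exact QNum_le_of_lt_two_mul (by omega) h1 h2 hn
  have h2' : 2 ≤ n / (d + 1) := (Nat.le_div_iff_mul_le (by omega)).2 h2
  rcases Nat.lt_or_ge (n / (d + 1)) 30 with h3 | h3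
  · exact QNum_le_of_div_lt hd' h2' h3
  · exact QNum_le_of_le_div hd' h3
end

section
/- Let a = 3 and let d ≥ 3(2^7 − 1) be a multiple of 3 (so that d+3 is a multiple of 3). Then q_d^{(3)}(n) ≥ Q_d^{(3)}(n) holds for all non-negative integers n except n = d, n = d+3, and n = d+6. -/
namespace AlderLevelThree

open Finset Nat

/-- The number of tuples `c` of natural numbers, one for each weight in the list, with
`∑ cᵢ wᵢ ≤ k`. -/
def boundedCount : List ℕ → ℕ → ℕ
  | [], _ => 1
  | w :: l, k => ∑ i ∈ range (k / w + 1), boundedCount l (k - i * w)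

/-- The tuples counted by `boundedCount`. -/
def boundedTuples : List ℕ → ℕ → Finset (List ℕ)
  | [], _ => {[]}
  | w :: l, k => (range (k / w + 1)).biUnion fun i =>
      (boundedTuples l (k - i * w)).image (List.cons i)

theorem card_boundedTuples_le (l : List ℕ) (k : ℕ) :
    (boundedTuples l k).card ≤ boundedCount l k := by
  induction l generalizing k with
  | nil => simp [boundedTuples, boundedCount]
  | cons w l ih =>
    exact card_biUnion_le.trans (sum_le_sum fun i _ => card_image_le.trans (ih _))

theorem map_mem_boundedTuples {α : Type*} (f w : α → ℕ) (l : List α) (k : ℕ)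
    (hw : ∀ x ∈ l, 0 < w x) (h : (l.map fun x => f x * w x).sum ≤ k) :
    l.map f ∈ boundedTuples (l.map w) k := by
  induction l generalizing k with
  | nil => simp [boundedTuples]
  | cons a l ih =>
    simp only [List.map_cons, List.sum_cons] at h
    simp only [List.map_cons, boundedTuples, mem_biUnion, mem_range, mem_image]
    refine ⟨f a, ?_, l.map f, ih _ (fun x hx => hw x (by simp [hx])) (by omega), rfl⟩
    rw [Nat.lt_succ_iff, Nat.le_div_iff_mul_le (hw a (by simp))]
    omega

theorem boundedCount_cons_of_lt {w k : ℕ} (l : List ℕ) (h : k < w) :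
    boundedCount (w :: l) k = boundedCount l k := by
  simp [boundedCount, Nat.div_eq_of_lt h]

theorem boundedCount_cons_add {w : ℕ} (l : List ℕ) (k : ℕ) (hw : 0 < w) :
    boundedCount (w :: l) (k + w) = boundedCount l (k + w) + boundedCount (w :: l) k := by
  simp only [boundedCount]
  rw [Nat.add_div_right _ hw, sum_range_succ', add_comm]
  congr 1
  · simp
  · refine sum_congr rfl fun i _ => ?_
    congr 1
    rw [add_mul, one_mul]
    omega

/-! ### Upper bound for the number of partitions into parts congruent to `±3` -/

/-- The weights `k, k, …, 2, 2, 1, 1`. -/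
def doubledWeights : ℕ → List ℕ
  | 0 => []
  | k + 1 => (k + 1) :: (k + 1) :: doubledWeights k

/-- The numbers `m i ± 3` with `1 ≤ i ≤ k`. -/
def largeParts (m : ℕ) : ℕ → List ℕ
  | 0 => []
  | k + 1 => (m * (k + 1) - 3) :: (m * (k + 1) + 3) :: largeParts m k

theorem mem_largeParts {m k x : ℕ} :
    x ∈ largeParts m k ↔ ∃ i, i < k ∧ (x = m * (i + 1) - 3 ∨ x = m * (i + 1) + 3) := by
  induction k with
  | zero => simp [largeParts]
  | succ k ih =>
    simp only [largeParts, List.mem_cons, ih]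
    constructor
    · rintro (h | h | ⟨i, hi, h⟩)
      · exact ⟨k, by omega, .inl h⟩
      · exact ⟨k, by omega, .inr h⟩
      · exact ⟨i, by omega, h⟩
    · rintro ⟨i, hi, h⟩
      rcases Nat.lt_succ_iff_lt_or_eq.mp hi with hi | rfl
      · exact .inr (.inr ⟨i, hi, h⟩)
      · tauto

theorem bounds_of_mem_largeParts {m k x : ℕ} (hm : 6 < m) (hx : x ∈ largeParts m k) :
    3 < x ∧ x ≤ m * k + 3 := by
  obtain ⟨i, hi, h⟩ := mem_largeParts.mp hx
  have h1 : m * (i + 1) ≤ m * k := Nat.mul_le_mul_left _ hi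
  have h2 : m * (i + 1) = m * i + m := by ring
  omega

theorem nodup_largeParts {m : ℕ} (hm : 6 < m) (k : ℕ) : (largeParts m k).Nodup := by
  induction k with
  | zero => simp [largeParts]
  | succ k ih =>
    have h2 : m * (k + 1) = m * k + m := by ring
    simp only [largeParts, List.nodup_cons, List.mem_cons, not_or]
    refine ⟨⟨by omega, fun h => ?_⟩, fun h => ?_, ih⟩ <;>
    · have := bounds_of_mem_largeParts hm h
      omega

theorem weight_sub {m : ℕ} (hm : 6 < m) (i : ℕ) : (m * (i + 1) - 3 + 3) / m = i + 1 := by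
  rw [Nat.sub_add_cancel (by nlinarith), Nat.mul_div_cancel_left _ (by omega)]

theorem weight_add {m : ℕ} (hm : 6 < m) (i : ℕ) : (m * (i + 1) + 3 + 3) / m = i + 1 := by
  rw [add_assoc, Nat.mul_add_div (by omega), Nat.div_eq_of_lt (by omega), add_zero]

theorem map_weight_largeParts {m : ℕ} (hm : 6 < m) (k : ℕ) :
    (largeParts m k).map (fun x => (x + 3) / m) = doubledWeights k := by
  induction k with
  | zero => rfl
  | succ k ih => simp only [largeParts, List.map_cons, ih, doubledWeights, weight_sub hm,
      weight_add hm]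

theorem weight_of_mem_largeParts {d k x : ℕ} (hd : 3 < d) (hx : x ∈ largeParts (d + 3) k) :
    0 < (x + 3) / (d + 3) ∧ (x + 3) / (d + 3) * d ≤ x := by
  obtain ⟨i, -, rfl | rfl⟩ := mem_largeParts.mp hx
  · rw [weight_sub (by omega)]
    refine ⟨by omega, ?_⟩
    have : (d + 3) * (i + 1) = (i + 1) * d + 3 * i + 3 := by ring
    omega
  · rw [weight_add (by omega)]
    refine ⟨by omega, ?_⟩
    nlinarith

theorem mem_largeParts_of_mod {d n x : ℕ} (hd : 3 < d) (hpos : 0 < x) (hle : x ≤ n)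
    (hx : x % (d + 3) = 3 % (d + 3) ∨ (x + 3) % (d + 3) = 0) :
    x = 3 ∨ x ∈ largeParts (d + 3) (n / d) := by
  rw [mem_largeParts]
  rcases hx with hx | hx
  · rw [Nat.mod_eq_of_lt (a := 3) (by omega)] at hx
    have h := Nat.div_add_mod x (d + 3)
    rw [hx] at h
    rcases hq : x / (d + 3) with _ | i
    · left; rw [hq] at h; omega
    · rw [hq] at h
      refine .inr ⟨i, ?_, .inr h.symm⟩
      rw [← Nat.succ_le_iff, Nat.le_div_iff_mul_le (by omega)]
      nlinarith
  · obtain ⟨q, hq⟩ := Nat.dvd_of_mod_eq_zero hx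
    rcases q with _ | i
    · omega
    · refine .inr ⟨i, ?_, .inl (by omega)⟩
      rw [← Nat.succ_le_iff, Nat.le_div_iff_mul_le (by omega)]
      nlinarith

theorem QNum_le_boundedCount {d : ℕ} (n : ℕ) (hd : 3 < d) :
    QNum 3 d n ≤ boundedCount (doubledWeights (n / d)) (n / d) := by
  set L := largeParts (d + 3) (n / d)
  have h3 : 3 ∉ L.toFinset := fun h => by
    have := bounds_of_mem_largeParts (by omega) (List.mem_toFinset.mp h)
    omega
  have hsub : ∀ p : n.Partition,
      (∀ x ∈ p.parts, x % (d + 3) = 3 % (d + 3) ∨ (x + 3) % (d + 3) = 0) →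
      ∀ x ∈ p.parts, x = 3 ∨ x ∈ L := fun p hp x hx =>
    mem_largeParts_of_mod hd (p.parts_pos hx)
      ((Multiset.le_sum_of_mem hx).trans_eq p.parts_sum) (hp x hx)
  have hsum : ∀ p : n.Partition,
      (∀ x ∈ p.parts, x % (d + 3) = 3 % (d + 3) ∨ (x + 3) % (d + 3) = 0) →
      n = p.parts.count 3 * 3 + (L.map fun x => p.parts.count x * x).sum := fun p hp => by
    have h := Finset.sum_multiset_count_of_subset p.parts (insert 3 L.toFinset) fun x hx => by
      simpa using hsub p hp x (Multiset.mem_toFinset.mp hx)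
    rw [p.parts_sum, Finset.sum_insert h3, List.sum_toFinset _ (nodup_largeParts (by omega) _)] at h
    simpa using h
  have hmem : ∀ p : {p : n.Partition // ∀ x ∈ p.parts,
      x % (d + 3) = 3 % (d + 3) ∨ (x + 3) % (d + 3) = 0},
      L.map (fun x => p.1.parts.count x) ∈ boundedTuples (doubledWeights (n / d)) (n / d) := by
    rintro ⟨p, hp⟩
    rw [← map_weight_largeParts (m := d + 3) (by omega)]
    refine map_mem_boundedTuples _ _ _ _ (fun x hx => (weight_of_mem_largeParts hd hx).1) ?_
    rw [Nat.le_div_iff_mul_le (by omega), ← List.sum_map_mul_right]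
    refine le_trans (List.sum_le_sum fun x hx => ?_) ((Nat.le_add_left _ _).trans_eq
      (hsum p hp).symm)
    rw [mul_assoc]
    exact Nat.mul_le_mul_left _ (weight_of_mem_largeParts hd hx).2
  refine le_trans ?_ (card_boundedTuples_le _ _)
  rw [QNum, ← Fintype.card_coe, ← Nat.card_eq_fintype_card]
  refine Nat.card_le_card_of_injective (fun p => ⟨_, hmem p⟩) ?_
  rintro ⟨p, hp⟩ ⟨q, hq⟩ h
  simp only [Subtype.mk.injEq] at h
  have hL : ∀ x ∈ L, p.parts.count x = q.parts.count x := List.map_inj_left.mp h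
  have h3 : p.parts.count 3 = q.parts.count 3 := by
    have h1 := hsum p hp
    have h2 := hsum q hq
    rw [List.map_congr_left fun x hx => by rw [hL x hx]] at h1
    omega
  refine Subtype.ext (Nat.Partition.ext (Multiset.ext.mpr fun x => ?_))
  by_cases hx : x = 3 ∨ x ∈ L
  · rcases hx with rfl | hx
    exacts [h3, hL x hx]
  · rw [Multiset.count_eq_zero_of_notMem fun h => hx (hsub p hp x h),
      Multiset.count_eq_zero_of_notMem fun h => hx (hsub q hq x h)]

/-! ### Lower bound for the number of partitions with large gaps -/

/-- The weights `j + 1, j, …, 2`. -/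
def descWeights : ℕ → List ℕ
  | 0 => []
  | j + 1 => (j + 2) :: descWeights j

/-- Increasing lists of `j + 1` parts, with all parts at least `a` and gaps at least `d`,
whose sum exceeds the least possible one by `e`. -/
def gapped (d : ℕ) : ℕ → ℕ → ℕ → Finset (List ℕ)
  | 0, a, e => {[a + e]}
  | j + 1, a, e => (range (e / (j + 2) + 1)).biUnion fun i =>
      (gapped d j (a + i + d) (e - i * (j + 2))).image (List.cons (a + i))

theorem card_gapped (d j a e : ℕ) : (gapped d j a e).card = boundedCount (descWeights j) e := by
  induction j generalizing a e with
  | zero => simp [gapped, descWeights, boundedCount]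
  | succ j ih =>
    simp only [gapped, descWeights, boundedCount]
    rw [card_biUnion]
    · refine sum_congr rfl fun i _ => ?_
      rw [Finset.card_image_of_injective _ List.cons_injective, ih]
    · intro i _ k _ hne
      rw [Function.onFun_apply, disjoint_left]
      intro l hl hk
      obtain ⟨_, -, rfl⟩ := mem_image.mp hl
      obtain ⟨_, -, h⟩ := mem_image.mp hk
      simp only [List.cons.injEq] at h
      omega

theorem gapped_spec {d j a e : ℕ} {l : List ℕ} (hl : l ∈ gapped d j a e) :
    (∀ x ∈ l, a ≤ x) ∧ l.Pairwise (fun x y => x + d ≤ y) ∧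
      2 * l.sum = 2 * (j + 1) * a + d * (j * (j + 1)) + 2 * e := by
  induction j generalizing a e l with
  | zero =>
    simp only [gapped, mem_singleton] at hl
    subst hl
    simp
    ring
  | succ j ih =>
    simp only [gapped, mem_biUnion, mem_range, mem_image] at hl
    obtain ⟨i, hi, l, hl, rfl⟩ := hl
    obtain ⟨h1, h2, h3⟩ := ih hl
    rw [Nat.lt_succ_iff, Nat.le_div_iff_mul_le (by omega)] at hi
    refine ⟨?_, ?_, ?_⟩
    · simp only [List.mem_cons, forall_eq_or_imp]
      exact ⟨by omega, fun x hx => by have := h1 x hx; omega⟩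
    · exact List.pairwise_cons.mpr ⟨h1, h2⟩
    · obtain ⟨f, rfl⟩ := Nat.exists_eq_add_of_le hi
      rw [Nat.add_sub_cancel_left] at h3
      rw [List.sum_cons, mul_add, h3]
      ring

theorem card_le_qNum {a d n : ℕ} (ha : 0 < a) (hd : 0 < d) (S : Finset (List ℕ))
    (hmin : ∀ l ∈ S, ∀ x ∈ l, a ≤ x) (hgap : ∀ l ∈ S, l.Pairwise (fun x y => x + d ≤ y))
    (hsum : ∀ l ∈ S, l.sum = n) : S.card ≤ qNum a d n := by
  rw [qNum, ← Fintype.card_coe, ← Nat.card_eq_fintype_card]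
  refine Nat.card_le_card_of_injective (fun l : S => ⟨⟨(l.1 : Multiset ℕ), ?_, ?_⟩, ?_, ?_⟩) ?_
  · intro x hx
    exact ha.trans_le (hmin l.1 l.2 x hx)
  · rw [Multiset.sum_coe, hsum l.1 l.2]
  · exact hmin l.1 l.2
  · refine ⟨l.1, rfl, (hgap l.1 l.2).imp fun {x y} h => ?_⟩
    rw [max_eq_right (by omega), min_eq_left (by omega)]
    omega
  · rintro ⟨l, hl⟩ ⟨r, hr⟩ h
    simp only [Subtype.mk.injEq, Nat.Partition.mk.injEq, Multiset.coe_eq_coe] at h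
    refine Subtype.ext (h.eq_of_pairwise ?_ (hgap l hl) (hgap r hr))
    intro x y _ _ h1 h2
    omega

theorem boundedCount_le_qNum {a d n j e : ℕ} (ha : 0 < a) (hd : 0 < d)
    (hn : 2 * n = 2 * (j + 1) * a + d * (j * (j + 1)) + 2 * e) :
    boundedCount (descWeights j) e ≤ qNum a d n := by
  rw [← card_gapped d j a e]
  refine card_le_qNum ha hd _ (fun l hl => (gapped_spec hl).1) (fun l hl => (gapped_spec hl).2.1)
    fun l hl => ?_
  have := (gapped_spec hl).2.2
  omega

theorem add_pow_succ_le (x w j : ℕ) :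
    (x + w) ^ (j + 1) ≤ x ^ (j + 1) + w * (j + 1) * (x + w) ^ j := by
  induction j with
  | zero => simp
  | succ j ih =>
    have h : x ^ (j + 1) ≤ (x + w) ^ (j + 1) := Nat.pow_le_pow_left (by omega) _
    calc (x + w) ^ (j + 2) = (x + w) ^ (j + 1) * (x + w) := pow_succ ..
      _ ≤ (x ^ (j + 1) + w * (j + 1) * (x + w) ^ j) * (x + w) := Nat.mul_le_mul_right _ ih
      _ = x ^ (j + 2) + w * x ^ (j + 1) + w * (j + 1) * (x + w) ^ (j + 1) := by ring
      _ ≤ x ^ (j + 2) + w * (x + w) ^ (j + 1) + w * (j + 1) * (x + w) ^ (j + 1) := by gcongr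
      _ = _ := by ring

theorem pow_le_boundedCount (j e : ℕ) :
    e ^ j ≤ (j + 1)! * j ! * boundedCount (descWeights j) e := by
  induction j generalizing e with
  | zero => simp [boundedCount, descWeights]
  | succ j ih =>
    have hfac : (j + 2)! * (j + 1)! = (j + 2) * (j + 1) * ((j + 1)! * j !) := by
      rw [Nat.factorial_succ (j + 1), Nat.factorial_succ j]; ring
    induction e using Nat.strong_induction_on with
    | _ e ihe =>
      rw [descWeights, hfac]
      rcases lt_or_ge e (j + 2) with he | he
      · rw [boundedCount_cons_of_lt _ he, pow_succ']
        calc e * e ^ j ≤ ((j + 2) * (j + 1)) * ((j + 1)! * j ! * boundedCount (descWeights j) e) :=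
              Nat.mul_le_mul (by nlinarith) (ih e)
          _ = _ := by ring
      · obtain ⟨f, rfl⟩ := Nat.exists_eq_add_of_le' he
        have h1 := ihe f (by omega)
        rw [descWeights, hfac] at h1
        rw [boundedCount_cons_add _ _ (by omega), mul_add]
        calc (f + (j + 2)) ^ (j + 1)
            ≤ f ^ (j + 1) + (j + 2) * (j + 1) * (f + (j + 2)) ^ j := add_pow_succ_le ..
          _ ≤ _ + (j + 2) * (j + 1) *
              ((j + 1)! * j ! * boundedCount (descWeights j) (f + (j + 2))) :=
            Nat.add_le_add h1 (Nat.mul_le_mul_left _ (ih _))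
          _ = _ := by ring

theorem QNum_le_qNum_of_pow {d n : ℕ} (j e : ℕ) (hd : 3 < d)
    (hn : 2 * n = 2 * (j + 1) * 3 + d * (j * (j + 1)) + 2 * e)
    (h : (j + 1)! * j ! * boundedCount (doubledWeights (n / d)) (n / d) ≤ e ^ j) :
    QNum 3 d n ≤ qNum 3 d n := by
  refine (QNum_le_boundedCount n hd).trans (le_trans ?_
    (boundedCount_le_qNum (by norm_num) (by omega) hn))
  exact Nat.le_of_mul_le_mul_left (h.trans (pow_le_boundedCount j e)) (by positivity)

/-! ### Analytic bound -/

theorem boundedCount_cons_mul_pow_le {t B : ℝ} (ht0 : 0 < t) (ht1 : t < 1) {w : ℕ} (hw : 0 < w)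
    (l : List ℕ) (hB : ∀ k, boundedCount l k * t ^ k ≤ B) (k : ℕ) :
    boundedCount (w :: l) k * t ^ k ≤ B * (1 - t ^ w)⁻¹ := by
  have hw1 : t ^ w < 1 := pow_lt_one₀ ht0.le ht1 hw.ne'
  have hB0 : 0 ≤ B := le_trans (by positivity) (hB 0)
  rw [← div_eq_mul_inv, le_div_iff₀ (by linarith)]
  induction k using Nat.strong_induction_on with
  | _ k ih =>
    rcases lt_or_ge k w with hk | hk
    · rw [boundedCount_cons_of_lt _ hk]
      have : 0 < t ^ w := by positivity
      have h0 : 0 ≤ (boundedCount l k : ℝ) * t ^ k := by positivity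
      nlinarith [hB k]
    · obtain ⟨f, rfl⟩ := Nat.exists_eq_add_of_le' hk
      rw [boundedCount_cons_add _ _ hw, Nat.cast_add]
      have h1 := mul_le_mul_of_nonneg_left (ih f (by omega)) (pow_pos ht0 w).le
      have h2 := mul_le_mul_of_nonneg_right (hB (f + w)) (sub_pos.mpr hw1).le
      rw [pow_add] at h2 ⊢
      nlinarith

theorem boundedCount_doubledWeights_mul_pow_le {t : ℝ} (ht0 : 0 < t) (ht1 : t < 1) (s k : ℕ) :
    boundedCount (doubledWeights s) k * t ^ k ≤ (∏ i ∈ range s, (1 - t ^ (i + 1))⁻¹) ^ 2 := by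
  induction s generalizing k with
  | zero => simpa [doubledWeights, boundedCount] using pow_le_one₀ ht0.le ht1.le
  | succ s ih =>
    refine (boundedCount_cons_mul_pow_le ht0 ht1 s.succ_pos _
      (boundedCount_cons_mul_pow_le ht0 ht1 s.succ_pos _ ih) k).trans_eq ?_
    rw [prod_range_succ, Nat.succ_eq_add_one]
    ring

theorem pow_div_one_sub_pow_le {t : ℝ} (ht0 : 0 < t) (ht1 : t < 1) (m : ℕ) :
    t ^ (m + 1) / (1 - t ^ (m + 1)) ≤ t / (1 - t) / (m + 1) := by
  have h1 : t ^ (m + 1) < 1 := pow_lt_one₀ ht0.le ht1 (by omega)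
  have h2 : ((m : ℝ) + 1) * t ^ m ≤ ∑ i ∈ range (m + 1), t ^ i := by
    have := card_nsmul_le_sum (range (m + 1)) (fun i => t ^ i) (t ^ m) fun i hi =>
      pow_le_pow_of_le_one ht0.le ht1.le (by have := mem_range.mp hi; omega)
    simpa using this
  have h3 := mul_neg_geom_sum t (m + 1)
  rw [div_div, div_le_div_iff₀ (by linarith) (by nlinarith), ← h3, pow_succ]
  have : 0 < (1 - t) * t := mul_pos (by linarith) ht0
  nlinarith

theorem prod_inv_one_sub_pow_le {t : ℝ} (ht0 : 0 < t) (ht1 : t < 1) (s : ℕ) :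
    ∏ i ∈ range s, (1 - t ^ (i + 1))⁻¹ ≤ Real.exp (9 / 5 * (t / (1 - t))) := by
  have hpos : ∀ i : ℕ, 0 < 1 - t ^ (i + 1) := fun i => by
    have := pow_lt_one₀ ht0.le ht1 (n := i + 1) (by omega)
    linarith
  rw [← Real.log_le_iff_le_exp (prod_pos fun i _ => inv_pos.mpr (hpos i)),
    Real.log_prod fun i _ => (inv_pos.mpr (hpos i)).ne']
  simp only [Real.log_inv]
  have hs : HasSum (fun m : ℕ => ∑ i ∈ range s, (t ^ (i + 1)) ^ (m + 1) / ((m : ℝ) + 1))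
      (∑ i ∈ range s, -Real.log (1 - t ^ (i + 1))) := by
    refine hasSum_sum fun i _ => Real.hasSum_pow_div_log_of_abs_lt_one ?_
    rw [abs_of_pos (by positivity)]
    linarith [hpos i]
  have hz : HasSum (fun m : ℕ => t / (1 - t) * (1 / ((m : ℝ) + 1) ^ 2))
      (t / (1 - t) * (Real.pi ^ 2 / 6)) := by
    refine HasSum.mul_left _ ?_
    have := (hasSum_nat_add_iff' 1).mpr hasSum_zeta_two
    simpa using this
  have hle := hasSum_le (fun m => ?_) hs hz
  · refine hle.trans ?_
    rw [mul_comm]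
    have : 0 < t / (1 - t) := div_pos ht0 (by linarith)
    refine mul_le_mul_of_nonneg_right ?_ this.le
    nlinarith [Real.pi_lt_d2, Real.pi_pos]
  · rw [← sum_div, div_le_iff₀ (by positivity)]
    have hgeom : ∑ i ∈ range s, (t ^ (i + 1)) ^ (m + 1) ≤ t ^ (m + 1) / (1 - t ^ (m + 1)) := by
      rw [le_div_iff₀ (hpos m)]
      have h := geom_sum_mul_neg (t ^ (m + 1)) s
      have : ∑ i ∈ range s, (t ^ (i + 1)) ^ (m + 1)
          = t ^ (m + 1) * ∑ i ∈ range s, (t ^ (m + 1)) ^ i := by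
        rw [mul_sum]
        refine sum_congr rfl fun i _ => ?_
        rw [← pow_mul, ← pow_mul, ← pow_add]
        congr 1
        ring
      rw [this, mul_assoc, h]
      have : 0 < t ^ (m + 1) := by positivity
      have : 0 ≤ (t ^ (m + 1)) ^ s := by positivity
      nlinarith
    refine (hgeom.trans (pow_div_one_sub_pow_le ht0 ht1 m)).trans_eq ?_
    field_simp

theorem boundedCount_doubledWeights_le_exp {k r : ℕ} (hr : 0 < r) (hk : k ≤ r ^ 2) :
    (boundedCount (doubledWeights k) k : ℝ) ≤ Real.exp (19 / 5 * r) := by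
  have hr' : (0 : ℝ) < r := by exact_mod_cast hr
  set t : ℝ := r / (r + 2) with ht
  have ht0 : 0 < t := by positivity
  have ht1 : t < 1 := by rw [ht, div_lt_one (by positivity)]; linarith
  have hu : t / (1 - t) = r / 2 := by rw [ht]; field_simp; ring
  have h := boundedCount_doubledWeights_mul_pow_le ht0 ht1 k k
  have hprod := pow_le_pow_left₀ (prod_nonneg fun i _ => inv_nonneg.mpr (sub_nonneg.mpr
    (pow_le_one₀ ht0.le ht1.le))) (prod_inv_one_sub_pow_le ht0 ht1 k) 2
  have hinv : t⁻¹ ^ k ≤ Real.exp (2 * r) := by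
    have h1 : t⁻¹ ≤ Real.exp (2 / r) := by
      have : t⁻¹ = 2 / r + 1 := by rw [ht]; field_simp; ring
      rw [this]
      exact Real.add_one_le_exp _
    have h2 : (k : ℝ) ≤ r ^ 2 := by exact_mod_cast hk
    refine (pow_le_pow_left₀ (by positivity) h1 k).trans ?_
    rw [← Real.exp_nat_mul, Real.exp_le_exp, mul_div_assoc', div_le_iff₀ hr']
    nlinarith
  calc (boundedCount (doubledWeights k) k : ℝ)
      = boundedCount (doubledWeights k) k * t ^ k * t⁻¹ ^ k := by
        rw [mul_assoc, ← mul_pow, mul_inv_cancel₀ ht0.ne', one_pow, mul_one]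
    _ ≤ Real.exp (9 / 5 * (t / (1 - t))) ^ 2 * Real.exp (2 * r) :=
        mul_le_mul (h.trans hprod) hinv (by positivity) (by positivity)
    _ = Real.exp (19 / 5 * r) := by
        rw [← Real.exp_nat_mul, ← Real.exp_add, hu]
        congr 1
        push_cast
        ring

theorem exp_mul_factorial_le {j : ℕ} (hj : 3 ≤ j) :
    (j + 1)! * j ! * Real.exp (19 / 5 * (j + 2 : ℕ)) ≤ (190 * (j + 1 : ℝ) ^ 2) ^ j := by
  induction j, hj using Nat.le_induction with
  | base =>
    have : Real.exp (19 / 5 * (3 + 2 : ℕ)) = Real.exp 1 ^ 19 := by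
      rw [← Real.exp_nat_mul]; norm_num
    rw [this]
    have h := pow_le_pow_left₀ (Real.exp_pos 1).le Real.exp_one_lt_d9.le 19
    norm_num [Nat.factorial] at h ⊢
    linarith
  | succ j hj ih =>
    have h4 : Real.exp (19 / 5) ≤ 190 := by
      have h := pow_le_pow_left₀ (Real.exp_pos 1).le Real.exp_one_lt_d9.le 4
      have h' : Real.exp (19 / 5) ≤ Real.exp 1 ^ 4 := by
        rw [← Real.exp_nat_mul]
        exact Real.exp_le_exp.mpr (by norm_num)
      exact h'.trans (h.trans (by norm_num))
    have hexp : Real.exp (19 / 5 * (j + 1 + 2 : ℕ)) =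
        Real.exp (19 / 5 * (j + 2 : ℕ)) * Real.exp (19 / 5) := by
      rw [← Real.exp_add]
      congr 1
      push_cast
      ring
    rw [hexp, Nat.factorial_succ (j + 1), Nat.factorial_succ j]
    push_cast at ih ⊢
    rw [Nat.factorial_succ j] at ih
    push_cast at ih
    calc _ = (((j : ℝ) + 1) * j ! * j ! * Real.exp (19 / 5 * (j + 2))) *
          (Real.exp (19 / 5) * ((j + 1 + 1) * (j + 1))) := by ring
      _ ≤ (190 * (j + 1 : ℝ) ^ 2) ^ j * (190 * ((j + 1 + 1) * (j + 1 + 1))) := by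
          gcongr
          linarith
      _ ≤ (190 * (j + 1 + 1 : ℝ) ^ 2) ^ j * (190 * ((j + 1 + 1) * (j + 1 + 1))) := by
          gcongr
          linarith
      _ = _ := by ring

/-! ### The main inequality -/

theorem QNum_eq_zero {d n : ℕ} (hd : 3 ∣ d) (hn : ¬ 3 ∣ n) : QNum 3 d n = 0 := by
  have : IsEmpty {p : n.Partition //
      ∀ x ∈ p.parts, x % (d + 3) = 3 % (d + 3) ∨ (x + 3) % (d + 3) = 0} := by
    refine ⟨fun p => hn ?_⟩
    rw [← p.1.parts_sum]
    refine Multiset.dvd_sum fun x hx => ?_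
    have h3 : 3 ∣ d + 3 := by omega
    rcases p.2 x hx with h | h
    · exact ((Nat.ModEq.dvd_iff (show x ≡ 3 [MOD d + 3] from h) h3).mpr dvd_rfl)
    · have := h3.trans (Nat.dvd_of_mod_eq_zero h)
      omega
  exact Nat.card_of_isEmpty

theorem three_le_qNum {d n : ℕ} (hd : 0 < d) (h : d + 9 ≤ n) : 3 ≤ qNum 3 d n := by
  have hcard : ({[n], [3, n - 3], [4, n - 4]} : Finset (List ℕ)).card = 3 := by
    rw [card_eq_three]
    exact ⟨_, _, _, by simp, by simp, by simp, rfl⟩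
  rw [← hcard]
  refine card_le_qNum (by norm_num) hd _ ?_ ?_ ?_
  all_goals
    simp only [mem_insert, mem_singleton, forall_eq_or_imp, forall_eq, List.mem_cons,
      List.not_mem_nil, false_imp_iff, implies_true, List.pairwise_cons, List.Pairwise.nil,
      List.sum_cons, List.sum_nil, and_true, true_and]
    omega

theorem QNum_le_qNum_of_lt {d n : ℕ} (hd : 3 < d) (hn : n < d) (h3 : 3 ∣ n) :
    QNum 3 d n ≤ qNum 3 d n := by
  have h : QNum 3 d n ≤ 1 := by
    simpa [Nat.div_eq_of_lt hn, doubledWeights, boundedCount] using QNum_le_boundedCount n hd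
  refine h.trans ?_
  rcases Nat.eq_zero_or_pos n with rfl | hpos
  · exact card_le_qNum (by norm_num) (by omega) {[]} (by simp) (by simp) (by simp)
  · exact card_le_qNum (by norm_num) (by omega) {[n]} (by simpa using Nat.le_of_dvd hpos h3)
      (by simp) (by simp)

theorem QNum_le_qNum_of_div {d n : ℕ} (j e : ℕ) (hd : 381 ≤ d) (hj : j * (j + 1) ≤ 2 * (n / d))
    (he : 2 * e + 6 * (j + 1) ≤ 381 * (2 * (n / d) - j * (j + 1)))
    (h : (j + 1)! * j ! * boundedCount (doubledWeights (n / d)) (n / d) ≤ e ^ j) :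
    QNum 3 d n ≤ qNum 3 d n := by
  obtain ⟨s, hs⟩ := Nat.even_mul_succ_self j
  have hn : d * (n / d) ≤ n := Nat.mul_div_le n d
  rw [hs] at hj he
  obtain ⟨f, hf⟩ := Nat.exists_eq_add_of_le (show s ≤ n / d by omega)
  rw [hf] at he hn
  have hle : 381 * f ≤ d * f := Nat.mul_le_mul_right _ hd
  rw [mul_add] at hn
  refine QNum_le_qNum_of_pow j (n - d * s - 3 * (j + 1)) (by omega) ?_
    (h.trans (Nat.pow_le_pow_left (by omega) _))
  rw [hs, mul_add d s s, mul_add 2 j 1]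
  omega

theorem QNum_le_qNum_of_sixteen_le {d n : ℕ} (hd : 381 ≤ d) (hk : 16 ≤ n / d) :
    QNum 3 d n ≤ qNum 3 d n := by
  have h4 : 4 ≤ Nat.sqrt (n / d) := Nat.le_sqrt.mpr hk
  obtain ⟨j, hj⟩ := Nat.exists_eq_add_of_le' (show 1 ≤ Nat.sqrt (n / d) by omega)
  have hlo : (j + 1) * (j + 1) ≤ n / d := hj ▸ Nat.sqrt_le (n / d)
  have hhi : n / d < (j + 2) * (j + 2) := by
    have := Nat.lt_succ_sqrt (n / d)
    rwa [hj] at this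
  refine QNum_le_qNum_of_div j (190 * (j + 1) ^ 2) hd (by nlinarith) ?_ ?_
  · have h1 : (j + 1) * (j + 2) ≤ 2 * (n / d) - j * (j + 1) := by
      have : (j + 1) * (j + 2) + j * (j + 1) = 2 * ((j + 1) * (j + 1)) := by ring
      omega
    refine le_trans ?_ (Nat.mul_le_mul_left _ h1)
    nlinarith
  · have h1 := boundedCount_doubledWeights_le_exp (k := n / d) (r := j + 2) (by omega)
      (by nlinarith)
    have h2 := exp_mul_factorial_le (j := j) (by omega)
    have h3 : ((j + 1)! * j ! * boundedCount (doubledWeights (n / d)) (n / d) : ℝ) ≤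
        (190 * (j + 1 : ℝ) ^ 2) ^ j := le_trans (by gcongr) h2
    exact_mod_cast h3

end AlderLevelThree

open AlderLevelThree in
theorem alder_level_three_multiple (d n : ℕ) (hd : 3 * (2 ^ 7 - 1) ≤ d) (hdvd : 3 ∣ d)
    (h1 : n ≠ d) (h2 : n ≠ d + 3) (h3 : n ≠ d + 6) :
    QNum 3 d n ≤ qNum 3 d n := by
  norm_num at hd
  by_cases hn : 3 ∣ n
  swap
  · rw [QNum_eq_zero hdvd hn]
    exact Nat.zero_le _
  rcases lt_or_ge n d with hlt | hge
  · exact QNum_le_qNum_of_lt (by omega) hlt hn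
  have hk1 : 1 ≤ n / d := (Nat.one_le_div_iff (by omega)).mpr hge
  rcases le_or_gt 16 (n / d) with h16 | h16
  · exact QNum_le_qNum_of_sixteen_le hd h16
  rcases le_or_gt 9 (n / d) with h9 | h9
  · refine QNum_le_qNum_of_div 3 1131 hd (by omega) (by omega) ?_
    have hexp := boundedCount_doubledWeights_le_exp (k := n / d) (r := 4) (by omega) (by omega)
    have hle : Real.exp (19 / 5 * (4 : ℕ)) ≤ Real.exp 1 ^ 16 := by
      rw [← Real.exp_nat_mul]
      exact Real.exp_le_exp.mpr (by norm_num)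
    have hpow := pow_le_pow_left₀ (Real.exp_pos 1).le Real.exp_one_lt_d9.le 16
    have hbound : (boundedCount (doubledWeights (n / d)) (n / d) : ℝ) ≤ (9000000 : ℕ) :=
      hexp.trans (hle.trans (hpow.trans (by norm_num)))
    rw [Nat.cast_le] at hbound
    calc _ ≤ Nat.factorial (3 + 1) * Nat.factorial 3 * 9000000 := Nat.mul_le_mul_left _ hbound
      _ ≤ _ := by norm_num [Nat.factorial]
  rcases le_or_gt 4 (n / d) with h4 | h4
  · refine QNum_le_qNum_of_div 2 372 hd (by omega) (by omega) ?_
    interval_cases n / d <;> decide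
  rcases le_or_gt 2 (n / d) with hge2 | hlt2
  · refine QNum_le_qNum_of_div 1 375 hd (by omega) (by omega) ?_
    interval_cases n / d <;> decide
  · have hk : n / d = 1 := by omega
    have hQ := QNum_le_boundedCount n (show 3 < d by omega)
    rw [hk] at hQ
    exact hQ.trans (le_trans (by decide) (three_le_qNum (by omega) (by omega)))
end

section
/- Let α ≥ 3 and let d ≥ max{4α, 2^{12} − 1}. Then for all integers n ≥ d+4, q_d^{(1)}(n) ≥ Q_{d−α}^{(1)}(n). -/
open Finset

/-- The integer `k * M + 1` or `k * M - 1` with `k = i.1 + 1`, according to `i.2`. -/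
def nearMultiple (M : ℕ) (i : ℕ × Bool) : ℕ :=
  if i.2 then (i.1 + 1) * M + 1 else (i.1 + 1) * M - 1

lemma mul_le_nearMultiple (d : ℕ) (i : ℕ × Bool) :
    (i.1 + 1) * (d + 2) ≤ nearMultiple (d + 3) i := by
  obtain ⟨k, b⟩ := i
  have : (k + 1) * (d + 3) = (k + 1) * (d + 2) + (k + 1) := by ring
  cases b <;> simp [nearMultiple] <;> omega

lemma nearMultiple_injective (d : ℕ) : Function.Injective (nearMultiple (d + 3)) := by
  rintro ⟨k, b⟩ ⟨l, c⟩ h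
  have hkl : k = l := by
    by_contra hne
    rcases lt_or_gt_of_ne hne with hlt | hlt
    · have := Nat.mul_le_mul_right (d + 3) (show k + 1 + 1 ≤ l + 1 by omega)
      rw [add_mul (k + 1)] at this
      cases b <;> cases c <;> simp [nearMultiple] at h <;> omega
    · have := Nat.mul_le_mul_right (d + 3) (show l + 1 + 1 ≤ k + 1 by omega)
      rw [add_mul (l + 1)] at this
      cases b <;> cases c <;> simp [nearMultiple] at h <;> omega
  subst hkl
  have : 0 < (k + 1) * (d + 3) := by positivity
  cases b <;> cases c <;> simp [nearMultiple] at h ⊢ <;> omega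

lemma exists_nearMultiple {d x : ℕ} (h0 : 0 < x) (h1 : x ≠ 1)
    (hx : x % (d + 3) = 1 % (d + 3) ∨ (x + 1) % (d + 3) = 0) :
    ∃ i, nearMultiple (d + 3) i = x := by
  rcases hx with hx | hx
  · rw [Nat.mod_eq_of_lt (show 1 < d + 3 by omega)] at hx
    have h := Nat.div_add_mod x (d + 3)
    rw [hx] at h
    obtain ⟨k, hk⟩ : ∃ k, x / (d + 3) = k + 1 :=
      Nat.exists_eq_succ_of_ne_zero (by intro h'; rw [h'] at h; omega)
    refine ⟨(k, true), ?_⟩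
    rw [hk, mul_comm] at h
    simpa [nearMultiple] using h
  · obtain ⟨k, hk⟩ := Nat.dvd_of_mod_eq_zero hx
    obtain ⟨k, rfl⟩ : ∃ l, k = l + 1 :=
      Nat.exists_eq_succ_of_ne_zero (by rintro rfl; omega)
    refine ⟨(k, false), ?_⟩
    rw [mul_comm] at hk
    simp [nearMultiple]
    omega

lemma sum_mul_count_le {ι : Type*} [Fintype ι] (v : ι → ℕ) (hv : Function.Injective v)
    (s : Multiset ℕ) : ∑ i, v i * s.count (v i) ≤ s.sum := by
  classical
  rw [Finset.sum_multiset_count, ← Finset.sum_image (f := fun x => x * s.count x)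
    (fun x _ y _ h => hv h)]
  rw [← Finset.sum_filter_add_sum_filter_not _ (· ∈ s)]
  have hz : ∑ x ∈ (univ.image v).filter (fun x => ¬ x ∈ s), x * s.count x = 0 :=
    Finset.sum_eq_zero fun x hx => by
      rw [Multiset.count_eq_zero_of_notMem (Finset.mem_filter.1 hx).2, mul_zero]
  rw [hz, add_zero]
  simp only [smul_eq_mul, mul_comm (s.count _)]
  refine Finset.sum_le_sum_of_subset fun x hx => ?_
  simpa using (Finset.mem_filter.1 hx).2

/-- The vectors of multiplicities of two-coloured partitions of size at most `N`. -/
def twoColoured (N : ℕ) : Finset (Fin N × Bool → Fin (N + 1)) :=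
  univ.filter fun f => ∑ i, ((i.1 : ℕ) + 1) * (f i : ℕ) ≤ N

lemma sum_count_nearMultiple_le (d n : ℕ) (p : n.Partition) :
    ∑ i : Fin (n / (d + 2)) × Bool,
      ((i.1 : ℕ) + 1) * p.parts.count (nearMultiple (d + 3) (i.1, i.2)) ≤ n / (d + 2) := by
  rw [Nat.le_div_iff_mul_le (by omega), Finset.sum_mul]
  calc _ ≤ ∑ i : Fin (n / (d + 2)) × Bool, nearMultiple (d + 3) (i.1, i.2) *
        p.parts.count (nearMultiple (d + 3) (i.1, i.2)) := by
        refine Finset.sum_le_sum fun i _ => ?_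
        rw [mul_right_comm]
        exact Nat.mul_le_mul_right _ (mul_le_nearMultiple d (i.1, i.2))
    _ ≤ p.parts.sum := by
        refine sum_mul_count_le
          (fun i : Fin (n / (d + 2)) × Bool => nearMultiple (d + 3) (i.1, i.2)) ?_ _
        rintro ⟨k, b⟩ ⟨l, c⟩ h
        have := nearMultiple_injective d h
        simp only [Prod.mk.injEq, Fin.val_inj] at this ⊢
        exact this
    _ = n := p.parts_sum

lemma Nat.Partition.eq_of_count_eq {n : ℕ} {p q : n.Partition}
    (h : ∀ x, x ≠ 1 → p.parts.count x = q.parts.count x) : p = q := by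
  have hf : p.parts.filter (· ≠ 1) = q.parts.filter (· ≠ 1) := by
    ext x
    by_cases hx : x = 1
    · simp [hx]
    · simp [hx, h x hx]
  have key : ∀ r : n.Partition,
      r.parts = Multiset.replicate (r.parts.count 1) 1 + r.parts.filter (· ≠ 1) := fun r => by
    conv_lhs => rw [← Multiset.filter_add_not (· = 1) r.parts]
    rw [Multiset.filter_eq']
  have hs : ∀ r : n.Partition, n = r.parts.count 1 + (r.parts.filter (· ≠ 1)).sum := fun r => by
    have := congrArg Multiset.sum (key r)
    rw [r.parts_sum] at this
    simpa using this
  have h1 := hs p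
  have h2 := hs q
  rw [hf] at h1
  ext1
  rw [key p, key q, hf, show p.parts.count 1 = q.parts.count 1 by omega]

lemma QNum_one_le_card_twoColoured (d n : ℕ) :
    QNum 1 d n ≤ #(twoColoured (n / (d + 2))) := by
  have hlt : ∀ (p : n.Partition) (i : Fin (n / (d + 2)) × Bool),
      p.parts.count (nearMultiple (d + 3) (i.1, i.2)) < n / (d + 2) + 1 := fun p i => by
    have h1 := sum_count_nearMultiple_le d n p
    have h2 := Finset.single_le_sum
      (f := fun i : Fin (n / (d + 2)) × Bool =>
        ((i.1 : ℕ) + 1) * p.parts.count (nearMultiple (d + 3) (i.1, i.2)))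
      (fun _ _ => Nat.zero_le _) (Finset.mem_univ i)
    have h3 := Nat.le_mul_of_pos_left
      (p.parts.count (nearMultiple (d + 3) (i.1, i.2))) (Nat.succ_pos (i.1 : ℕ))
    simp only [Nat.succ_eq_add_one] at h3
    omega
  rw [QNum, ← Nat.card_eq_finsetCard]
  refine Nat.card_le_card_of_injective
    (fun p => ⟨fun i => ⟨p.1.parts.count (nearMultiple (d + 3) (i.1, i.2)), hlt p.1 i⟩, ?_⟩) ?_
  · simpa [twoColoured] using sum_count_nearMultiple_le d n p.1
  · rintro ⟨p, hp⟩ ⟨q, hq⟩ h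
    simp only [Subtype.mk.injEq] at h
    refine Subtype.ext (Nat.Partition.eq_of_count_eq fun x hx => ?_)
    by_cases hmem : x ∈ p.parts ∨ x ∈ q.parts
    · obtain ⟨h0, hmod, hle⟩ : 0 < x ∧
          (x % (d + 3) = 1 % (d + 3) ∨ (x + 1) % (d + 3) = 0) ∧ x ≤ n := by
        rcases hmem with hm | hm
        · exact ⟨p.parts_pos hm, hp x hm, p.le_of_mem_parts hm⟩
        · exact ⟨q.parts_pos hm, hq x hm, q.le_of_mem_parts hm⟩
      obtain ⟨⟨k, b⟩, hi⟩ := exists_nearMultiple h0 hx hmod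
      have hk : k < n / (d + 2) := by
        have := mul_le_nearMultiple d (k, b)
        exact (Nat.le_div_iff_mul_le (by omega)).2 (this.trans (hi.trans_le hle))
      have := congrArg Fin.val (congrFun h (⟨k, hk⟩, b))
      simpa [hi] using this
    · push Not at hmem
      rw [Multiset.count_eq_zero_of_notMem hmem.1, Multiset.count_eq_zero_of_notMem hmem.2]

lemma card_twoColoured_mul_le {y : ℝ} (h0 : 0 < y) (h1 : y < 1) (N : ℕ) :
    (#(twoColoured N) : ℝ) * (y ^ N * (∏ k ∈ range N, (1 - y ^ (k + 1))) ^ 2) ≤ 1 := by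
  have hpos : ∀ k : ℕ, 0 < 1 - y ^ (k + 1) := fun k =>
    sub_pos.2 (pow_lt_one₀ h0.le h1 (by omega))
  have hgeom : ∀ k : ℕ, (∑ j : Fin (N + 1), y ^ ((k + 1) * (j : ℕ))) ≤ (1 - y ^ (k + 1))⁻¹ :=
    fun k => by
      have h := Fin.sum_univ_eq_sum_range (fun j => y ^ ((k + 1) * j)) (N + 1)
      rw [h, ← one_div, le_div_iff₀ (hpos k)]
      simp only [pow_mul]
      rw [geom_sum_mul_neg]
      have : 0 < (y ^ (k + 1)) ^ (N + 1) := by positivity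
      linarith
  have hsum : (#(twoColoured N) : ℝ) * y ^ N ≤
      ∏ i : Fin N × Bool, (1 - y ^ ((i.1 : ℕ) + 1))⁻¹ := by
    calc (#(twoColoured N) : ℝ) * y ^ N = ∑ f ∈ twoColoured N, y ^ N := by simp
      _ ≤ ∑ f ∈ twoColoured N, y ^ (∑ i, ((i.1 : ℕ) + 1) * (f i : ℕ)) :=
          Finset.sum_le_sum fun f hf =>
            pow_le_pow_of_le_one h0.le h1.le (Finset.mem_filter.1 hf).2
      _ ≤ ∑ f : Fin N × Bool → Fin (N + 1), y ^ (∑ i, ((i.1 : ℕ) + 1) * (f i : ℕ)) :=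
          Finset.sum_le_sum_of_subset_of_nonneg (Finset.subset_univ _)
            fun _ _ _ => by positivity
      _ = ∏ i : Fin N × Bool, ∑ j : Fin (N + 1), y ^ (((i.1 : ℕ) + 1) * (j : ℕ)) := by
          rw [Finset.prod_univ_sum]
          simp [Finset.prod_pow_eq_pow_sum]
      _ ≤ _ := Finset.prod_le_prod (fun _ _ => by positivity) fun i _ => hgeom i.1
  have hprod : ∏ i : Fin N × Bool, (1 - y ^ ((i.1 : ℕ) + 1))⁻¹ =
      ((∏ k ∈ range N, (1 - y ^ (k + 1))) ^ 2)⁻¹ := by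
    rw [Fintype.prod_prod_type]
    simp only [Finset.prod_const, Finset.card_univ, Fintype.card_bool]
    rw [Finset.prod_pow, Finset.prod_inv_distrib, inv_pow,
      Fin.prod_univ_eq_prod_range (fun k => 1 - y ^ (k + 1))]
  rw [hprod] at hsum
  have hP : 0 < (∏ k ∈ range N, (1 - y ^ (k + 1))) ^ 2 :=
    pow_pos (Finset.prod_pos fun k _ => hpos k) 2
  rw [← mul_assoc]
  calc _ ≤ _ := mul_le_mul_of_nonneg_right hsum hP.le
    _ = 1 := inv_mul_cancel₀ hP.ne'

lemma one_fourth_le_prod (K : ℕ) :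
    (1 / 4 : ℝ) ≤ ∏ i ∈ range K, (1 - (1 / 2 : ℝ) ^ (i + 1)) := by
  have key : ∀ K : ℕ, (1 / 4 : ℝ) + (1 / 2) ^ (K + 2) ≤
      ∏ i ∈ range (K + 1), (1 - (1 / 2 : ℝ) ^ (i + 1)) := fun K => by
    induction K with
    | zero => norm_num
    | succ K ih =>
      rw [Finset.prod_range_succ]
      have hu : (1 / 2 : ℝ) ^ (K + 2) ≤ 1 / 4 := by
        calc (1 / 2 : ℝ) ^ (K + 2) ≤ (1 / 2) ^ 2 :=
              pow_le_pow_of_le_one (by norm_num) (by norm_num) (by omega)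
          _ = 1 / 4 := by norm_num
      have hu0 : (0 : ℝ) < (1 / 2) ^ (K + 2) := by positivity
      refine le_trans ?_ (mul_le_mul_of_nonneg_right ih (by rw [add_assoc]; norm_num at hu ⊢; linarith))
      rw [show K + 1 + 2 = (K + 2) + 1 by ring, show K + 1 + 1 = K + 2 by ring, pow_succ]
      nlinarith
  cases K with
  | zero => norm_num
  | succ K => exact le_trans (le_add_of_nonneg_right (by positivity)) (key K)

lemma div_pow_le_div_add {t : ℕ} (ht : 0 < t) (k : ℕ) :
    ((t : ℝ) / (t + 1)) ^ k ≤ t / (t + k) := by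
  have ht' : (0 : ℝ) < t := by exact_mod_cast ht
  have h := one_add_mul_le_pow (show (-2 : ℝ) ≤ 1 / t by
    linarith [show (0 : ℝ) < 1 / t by positivity]) k
  rw [show (t : ℝ) / (t + 1) = (1 + 1 / (t : ℝ))⁻¹ by field_simp, inv_pow]
  calc ((1 + 1 / (t : ℝ)) ^ k)⁻¹ ≤ (1 + k * (1 / (t : ℝ)))⁻¹ := inv_anti₀ (by positivity) h
    _ = t / (t + k) := by field_simp

lemma prod_div_add_eq (t : ℕ) :
    ∏ r ∈ range t, (((r : ℝ) + 1) / (t + r + 1)) = ((t.centralBinom : ℕ) : ℝ)⁻¹ := by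
  rw [Finset.prod_div_distrib]
  have h1 : ∏ r ∈ range t, ((r : ℝ) + 1) = (t.factorial : ℝ) := by
    rw [← Finset.prod_range_add_one_eq_factorial]; push_cast; rfl
  have h2 : ∏ r ∈ range t, ((t : ℝ) + r + 1) = ((t + 1).ascFactorial t : ℝ) := by
    rw [Nat.ascFactorial_eq_prod_range]; push_cast
    exact Finset.prod_congr rfl fun _ _ => by ring
  rw [h1, h2, Nat.centralBinom_eq_two_mul_choose]
  have h3 := Nat.ascFactorial_eq_factorial_mul_choose t t
  rw [h3, two_mul]
  have : (t.factorial : ℝ) ≠ 0 := by exact_mod_cast t.factorial_ne_zero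
  push_cast
  field_simp

lemma one_sixteenth_pow_le_prod {t : ℕ} (ht : 0 < t) (N : ℕ) :
    (1 / 16 : ℝ) ^ t ≤ ∏ k ∈ range N, (1 - ((t : ℝ) / (t + 1)) ^ (k + 1)) := by
  set y : ℝ := (t : ℝ) / (t + 1) with hy
  have ht' : (0 : ℝ) < t := by exact_mod_cast ht
  have hy0 : 0 < y := by positivity
  have hy1 : y < 1 := (div_lt_one (by positivity)).2 (by linarith)
  have hpos : ∀ k : ℕ, 0 < 1 - y ^ (k + 1) := fun k =>
    sub_pos.2 (pow_lt_one₀ hy0.le hy1 (by omega))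
  have hfirst : (1 / 4 : ℝ) ^ t ≤ ∏ r ∈ range t, (1 - y ^ (r + 1)) := by
    calc (1 / 4 : ℝ) ^ t ≤ ((t.centralBinom : ℕ) : ℝ)⁻¹ := by
          rw [one_div, inv_pow]
          refine inv_anti₀ (by exact_mod_cast t.centralBinom_pos) ?_
          have : t.centralBinom ≤ 4 ^ t := by
            rw [Nat.centralBinom_eq_two_mul_choose, show 4 = 2 ^ 2 by norm_num, ← pow_mul]
            exact Nat.choose_le_two_pow _ _
          exact_mod_cast this
      _ = ∏ r ∈ range t, (((r : ℝ) + 1) / (t + r + 1)) := (prod_div_add_eq t).symm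
      _ ≤ _ := by
          refine Finset.prod_le_prod (fun _ _ => by positivity) fun r _ => ?_
          have := div_pow_le_div_add ht (r + 1)
          push_cast at this
          rw [← add_assoc] at this
          have h2 : ((r : ℝ) + 1) / (t + r + 1) = 1 - t / (t + r + 1) := by
            field_simp; ring
          rw [h2]
          linarith
  have hhalf : y ^ t ≤ 1 / 2 := by
    refine (div_pow_le_div_add ht t).trans_eq ?_
    field_simp; norm_num
  have hblocks : ∀ K : ℕ, ((1 / 4 : ℝ) * ∏ i ∈ range K, (1 - (1 / 2 : ℝ) ^ (i + 1))) ^ t ≤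
      ∏ k ∈ range ((K + 1) * t), (1 - y ^ (k + 1)) := fun K => by
    induction K with
    | zero => simpa using hfirst
    | succ K ih =>
      rw [show (K + 1 + 1) * t = (K + 1) * t + t by ring,
        Finset.prod_range_add (fun k => 1 - y ^ (k + 1)), Finset.prod_range_succ, ← mul_assoc,
        mul_pow]
      have hK : (0 : ℝ) ≤ 1 - (1 / 2) ^ (K + 1) :=
        sub_nonneg.2 (pow_le_one₀ (by norm_num) (by norm_num))
      refine mul_le_mul ih ?_ (pow_nonneg hK _) (Finset.prod_nonneg fun k _ => (hpos k).le)
      refine le_of_eq_of_le (by rw [Finset.prod_const, Finset.card_range]) <|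
        Finset.prod_le_prod (f := fun _ => 1 - (1 / 2 : ℝ) ^ (K + 1)) (fun _ _ => hK) fun r _ => ?_
      have : y ^ ((K + 1) * t + r + 1) ≤ (1 / 2) ^ (K + 1) := by
        calc y ^ ((K + 1) * t + r + 1) ≤ y ^ (t * (K + 1)) :=
              pow_le_pow_of_le_one hy0.le hy1.le (by rw [mul_comm]; omega)
          _ = (y ^ t) ^ (K + 1) := pow_mul _ _ _
          _ ≤ _ := pow_le_pow_left₀ (by positivity) hhalf _
      linarith
  calc (1 / 16 : ℝ) ^ t ≤ ((1 / 4 : ℝ) * ∏ i ∈ range N, (1 - (1 / 2 : ℝ) ^ (i + 1))) ^ t := by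
        refine pow_le_pow_left₀ (by norm_num) ?_ t
        linarith [one_fourth_le_prod N]
    _ ≤ ∏ k ∈ range ((N + 1) * t), (1 - y ^ (k + 1)) := hblocks N
    _ ≤ _ := by
        have hN : N ≤ (N + 1) * t := by nlinarith
        obtain ⟨c, hc⟩ := Nat.exists_eq_add_of_le hN
        rw [hc, Finset.prod_range_add]
        refine mul_le_of_le_one_right (Finset.prod_nonneg fun k _ => (hpos k).le) ?_
        refine Finset.prod_le_one (fun k _ => (hpos _).le) fun k _ => ?_
        linarith [pow_pos hy0 (N + k + 1)]

lemma card_twoColoured_le {t : ℕ} (ht : 0 < t) (N : ℕ) :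
    (#(twoColoured N) : ℝ) ≤ 256 ^ t * (1 + 1 / (t : ℝ)) ^ N := by
  have ht' : (0 : ℝ) < t := by exact_mod_cast ht
  have h := card_twoColoured_mul_le (y := (t : ℝ) / (t + 1)) (by positivity)
    ((div_lt_one (by positivity)).2 (by linarith)) N
  have hP := pow_le_pow_left₀ (by positivity) (one_sixteenth_pow_le_prod ht N) 2
  have hle : (#(twoColoured N) : ℝ) * (((t : ℝ) / (t + 1)) ^ N * ((1 / 16) ^ t) ^ 2) ≤ 1 :=
    le_trans (by gcongr) h
  rw [← le_div_iff₀ (by positivity)] at hle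
  refine hle.trans_eq ?_
  rw [← pow_mul, mul_comm t 2, pow_mul, one_div, mul_inv, ← inv_pow, ← inv_pow, mul_comm,
    inv_div]
  congr 2
  · norm_num
  · field_simp

lemma card_twoColoured_le_two_pow (N : ℕ) : #(twoColoured N) ≤ 2 ^ (N + 4) := by
  have h := card_twoColoured_mul_le (y := 1 / 2) (by norm_num) (by norm_num) N
  have hP := pow_le_pow_left₀ (by positivity) (one_fourth_le_prod N) 2
  have hle : (#(twoColoured N) : ℝ) * ((1 / 2) ^ N * (1 / 4) ^ 2) ≤ 1 :=
    le_trans (by gcongr) h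
  rw [← le_div_iff₀ (by positivity)] at hle
  have : (#(twoColoured N) : ℝ) ≤ 2 ^ (N + 4) := by
    refine hle.trans_eq ?_
    rw [one_div_pow, pow_add]
    field_simp
    norm_num
  exact_mod_cast this

lemma card_twoColoured_le_pow {t N : ℕ} (ht : 6 ≤ t) (hN : 6 * N < 5 * (t + 1) ^ 2 + 7 * (t + 1)) :
    #(twoColoured N) ≤ 1024 ^ t := by
  have ht' : (6 : ℝ) ≤ t := by exact_mod_cast ht
  have hN' : (6 : ℝ) * N + 1 ≤ 5 * (t + 1) ^ 2 + 7 * (t + 1) := by exact_mod_cast hN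
  have hexp : (1 + 1 / (t : ℝ)) ^ N ≤ 4 ^ t := by
    calc (1 + 1 / (t : ℝ)) ^ N ≤ (Real.exp (1 / t)) ^ N := by
          refine pow_le_pow_left₀ (by positivity) ?_ N
          linarith [Real.add_one_le_exp (1 / (t : ℝ))]
      _ = Real.exp (N / t) := by rw [← Real.exp_nat_mul]; congr 1; ring
      _ ≤ Real.exp (t * Real.log 4) := by
          refine Real.exp_le_exp.2 ?_
          rw [div_le_iff₀ (by linarith), show (4 : ℝ) = 2 ^ 2 by norm_num, Real.log_pow]
          have := Real.log_two_gt_d9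
          push_cast
          nlinarith [mul_le_mul_of_nonneg_left this.le (show (0 : ℝ) ≤ t * t by positivity)]
      _ = 4 ^ t := by rw [Real.exp_nat_mul, Real.exp_log (by norm_num)]
  have h : (#(twoColoured N) : ℝ) ≤ 1024 ^ t := by
    refine (card_twoColoured_le (t := t) (by omega) N).trans ?_
    rw [show (1024 : ℝ) = 256 * 4 by norm_num, mul_pow]
    exact mul_le_mul_of_nonneg_left hexp (by positivity)
  exact_mod_cast h

/-- Choosing the `t` smallest parts freely in windows of length `m + 1` separated by gaps `d`. -/
lemma pow_le_qNum_s8 {d m t n : ℕ} (ht : 0 < t)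
    (h : 2 * (t + 1) + d * (t * (t + 1)) + m * (t * (t + 3)) ≤ 2 * n) :
    (m + 1) ^ t ≤ qNum 1 d n := by
  let w : (Fin t → Fin (m + 1)) → Fin t → ℕ := fun e i => 1 + i * (d + m) + e i
  let v : (Fin t → Fin (m + 1)) → Fin (t + 1) → ℕ := fun e =>
    Fin.snoc (α := fun _ => ℕ) (w e) (n - ∑ i, w e i)
  have hw : ∀ e i, w e i ≤ 1 + (t - 1) * (d + m) + m := fun e i => by
    have h1 := Nat.mul_le_mul_right (d + m) (show (i : ℕ) ≤ t - 1 by omega)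
    have := (e i).2
    simp only [w]
    omega
  have hsum : ∀ e, 2 * ∑ i, w e i ≤ 2 * t + t * (t - 1) * (d + m) + 2 * t * m := fun e => by
    have h1 : ∑ i, w e i ≤ ∑ i : Fin t, (1 + i * (d + m) + m) :=
      Finset.sum_le_sum fun i _ => by have := (e i).2; simp only [w]; omega
    have h2 : 2 * ∑ i : Fin t, (1 + (i : ℕ) * (d + m) + m) =
        2 * t + t * (t - 1) * (d + m) + 2 * t * m := by
      rw [Fin.sum_univ_eq_sum_range (fun i => 1 + i * (d + m) + m), Finset.sum_add_distrib,
        Finset.sum_add_distrib, ← Finset.sum_mul, ← Finset.sum_range_id_mul_two]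
      simp
      ring
    omega
  have hlast : ∀ e i, w e i + d + ∑ i, w e i ≤ n := fun e i => by
    have h1 := hw e i
    have h2 := hsum e
    obtain ⟨s, rfl⟩ : ∃ s, t = s + 1 := ⟨t - 1, by omega⟩
    simp only [Nat.add_sub_cancel] at h1 h2
    nlinarith
  have hgap : ∀ e, ∀ i j : Fin (t + 1), i < j → v e i + d ≤ v e j := fun e i j hij => by
    induction i using Fin.lastCases with
    | last => exact absurd hij (not_lt.2 (Fin.le_last j))
    | cast i =>
      induction j using Fin.lastCases with
      | last =>
        have := hlast e i
        simp only [v, Fin.snoc_castSucc, Fin.snoc_last]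
        omega
      | cast j =>
        have hij' : (i : ℕ) + 1 ≤ j := hij
        have := Nat.mul_le_mul_right (d + m) hij'
        have := (e i).2
        simp only [v, Fin.snoc_castSucc, w]
        rw [add_mul] at *
        omega
  have hone : ∀ e i, 1 ≤ v e i := fun e i => by
    induction i using Fin.lastCases with
    | last =>
      have := hlast e ⟨0, ht⟩
      have h1 : 1 ≤ w e ⟨0, ht⟩ := by simp only [w]; omega
      simp only [v, Fin.snoc_last]
      omega
    | cast i => simp only [v, Fin.snoc_castSucc, w]; omega
  have hvsum : ∀ e, ∑ i, v e i = n := fun e => by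
    rw [Fin.sum_univ_castSucc]
    have := hlast e ⟨0, ht⟩
    simp only [v, Fin.snoc_castSucc, Fin.snoc_last]
    omega
  have hcard : (m + 1) ^ t = Nat.card (Fin t → Fin (m + 1)) := by simp
  rw [hcard, qNum]
  refine Nat.card_le_card_of_injective
    (fun e => ⟨⟨(List.ofFn (v e) : Multiset ℕ), ?_, ?_⟩, ?_, ?_⟩) ?_
  · intro x hx
    obtain ⟨i, rfl⟩ := (List.mem_ofFn' _ _).1 (Multiset.mem_coe.1 hx)
    exact hone e i
  · rw [Multiset.sum_coe, List.sum_ofFn, hvsum]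
  · intro x hx
    obtain ⟨i, rfl⟩ := (List.mem_ofFn' _ _).1 (Multiset.mem_coe.1 hx)
    exact hone e i
  · refine ⟨_, rfl, List.pairwise_ofFn.2 fun i j hij => ?_⟩
    have := hgap e i j hij
    omega
  · intro e e' hee
    simp only [Subtype.mk.injEq, Nat.Partition.mk.injEq, Multiset.coe_eq_coe] at hee
    have hs : ∀ e, (List.ofFn (v e)).Pairwise (· ≤ ·) := fun e =>
      List.pairwise_ofFn.2 fun i j hij => by have := hgap e i j hij; omega
    have hv := List.ofFn_injective (hee.eq_of_pairwise' (hs e) (hs e'))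
    funext i
    have := congrFun hv i.castSucc
    simp only [v, Fin.snoc_castSucc, w] at this
    exact Fin.ext (by omega)

lemma three_le_qNum {d n : ℕ} (hd : 0 < d) (hn : d + 4 ≤ n) : 3 ≤ qNum 1 d n := by
  let l : Fin 3 → List ℕ := ![[n], [n - 1, 1], [n - 2, 2]]
  have hcard : 3 = Nat.card (Fin 3) := by simp
  rw [hcard, qNum]
  refine Nat.card_le_card_of_injective
    (fun e => ⟨⟨(l e : Multiset ℕ), ?_, ?_⟩, ?_, ?_⟩) ?_
  · fin_cases e <;> simp [l] <;> omega
  · fin_cases e <;> simp [l] <;> omega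
  · fin_cases e <;> simp [l] <;> omega
  · refine ⟨_, rfl, ?_⟩
    fin_cases e <;> simp [l] <;> omega
  · intro e e' hee
    simp only [Subtype.mk.injEq, Nat.Partition.mk.injEq] at hee
    have hmem : ∀ x, x ∈ l e ↔ x ∈ l e' := fun x => by
      rw [← Multiset.mem_coe, hee, Multiset.mem_coe]
    have h1 := hmem 1
    have h2 := hmem 2
    fin_cases e <;> fin_cases e' <;> simp [l] at h1 h2 ⊢ <;> omega

lemma card_twoColoured_le_three {N : ℕ} (hN : N ≤ 1) : #(twoColoured N) ≤ 3 := by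
  interval_cases N <;> decide

theorem shift_level_one_general (α d n : ℕ) (hα : 3 ≤ α)
    (hd : max (4 * α) (2 ^ 12 - 1) ≤ d) (hn : d + 4 ≤ n) :
    QNum 1 (d - α) n ≤ qNum 1 d n := by
  obtain ⟨hd4, hd12⟩ : 4 * α ≤ d ∧ 4095 ≤ d := by
    rw [max_le_iff] at hd
    exact ⟨hd.1, by omega⟩
  refine (QNum_one_le_card_twoColoured (d - α) n).trans ?_
  set N := n / (d - α + 2) with hN
  have hNn : N * (d - α + 2) ≤ n := Nat.div_mul_le_self n _
  have hNn' : N * (3 * d + 8) ≤ 4 * n := by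
    have := Nat.mul_le_mul_left N (show 3 * d + 8 ≤ 4 * (d - α + 2) by omega)
    linarith
  rcases Nat.lt_or_ge N 37 with hN37 | hN37
  · rcases Nat.lt_or_ge N 2 with hN2 | hN2
    · exact (card_twoColoured_le_three (by omega)).trans (three_le_qNum (by omega) hn)
    refine (card_twoColoured_le_two_pow N).trans ?_
    rcases Nat.lt_or_ge N 7 with hN7 | hN7
    · have hn2 := (Nat.mul_le_mul_right (3 * d + 8) hN2).trans hNn'
      refine le_trans ?_ (pow_le_qNum_s8 (m := 1023) (t := 1) one_pos (by omega))
      exact Nat.pow_le_pow_right two_pos (show N + 4 ≤ 10 by omega)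
    rcases Nat.lt_or_ge N 18 with hN18 | hN18
    · have hn7 := (Nat.mul_le_mul_right (3 * d + 8) hN7).trans hNn'
      refine le_trans ?_ (pow_le_qNum_s8 (m := 1500) (t := 2) two_pos (by omega))
      exact (Nat.pow_le_pow_right two_pos (show N + 4 ≤ 21 by omega)).trans (by norm_num)
    · have hn18 := (Nat.mul_le_mul_right (3 * d + 8) hN18).trans hNn'
      refine le_trans ?_ (pow_le_qNum_s8 (m := d / 4) (t := 4) (by norm_num) (by omega))
      calc 2 ^ (N + 4) ≤ 1024 ^ 4 :=
            (Nat.pow_le_pow_right two_pos (show N + 4 ≤ 40 by omega)).trans (by norm_num)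
        _ ≤ (d / 4 + 1) ^ 4 := Nat.pow_le_pow_left (by omega) 4
  · let P : ℕ → Prop := fun t => 5 * t ^ 2 + 7 * t ≤ 6 * N
    have hP6 : P 6 := by simp only [P]; omega
    have h6N : 6 ≤ N := by omega
    set t := Nat.findGreatest P N with ht
    have ht6 : 6 ≤ t := Nat.le_findGreatest h6N hP6
    have hPt : 5 * t ^ 2 + 7 * t ≤ 6 * N := Nat.findGreatest_spec h6N hP6
    have hlt : 6 * N < 5 * (t + 1) ^ 2 + 7 * (t + 1) := by
      rcases Nat.lt_or_ge N (t + 1) with h | h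
      · nlinarith
      · exact not_le.1 (Nat.findGreatest_is_greatest (P := P) (Nat.lt_succ_self t) h)
    refine (card_twoColoured_le_pow ht6 hlt).trans ?_
    refine (Nat.pow_le_pow_left (show 1024 ≤ d / 4 + 1 by omega) t).trans
      (pow_le_qNum_s8 (by omega) ?_)
    have hm : 4 * (d / 4) ≤ d := Nat.mul_div_le d 4
    have h1 := Nat.mul_le_mul_right (t * (t + 3)) hm
    have h2 := Nat.mul_le_mul_left d hPt
    nlinarith
end

section
/- Let d ≥ 254 be an even integer with d not of the form 2^r − 2 for any integer r. Then for all integers n ≥ d+7, q_d^{(2)}(n) ≥ Q_d^{(2)}(n). -/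
open Finset in
/-- The number of partitions into parts congruent to `±2` modulo `d + 3` is at most the number of
two-coloured partitions of the integers up to `N`, given by their multiplicities. -/
theorem QNum_two_le_card_multiplicities {d N n : ℕ} (hd : 2 ≤ d) (hn : n < (N + 1) * (d + 1)) :
    QNum 2 d n ≤ #{c ∈ Fintype.piFinset (fun _ : Fin N × Bool => range (N + 1)) |
      ∑ i, (i.1.val + 1) * c i ≤ N} := by
  set v : Fin N × Bool → ℕ := fun i => i.1 * (d + 3) + d + 1 + 4 * i.2.toNat with hv
  have v_ge (i) : (i.1.val + 1) * (d + 1) ≤ v i := by simp only [hv]; nlinarith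
  have v_lt (i j : Fin N × Bool) (hij : i.1 < j.1) : v i < v j := by
    have : (i.1.val + 1) * (d + 3) ≤ j.1 * (d + 3) := Nat.mul_le_mul_right _ hij
    have := i.2.toNat_le
    simp only [hv]
    linarith
  have v_inj : Function.Injective v := by
    intro i j h
    have h1 : i.1 = j.1 := by
      by_contra hne
      rcases lt_or_gt_of_ne hne with hlt | hlt
      · exact (v_lt i j hlt).ne h
      · exact (v_lt j i hlt).ne h.symm
    rcases i with ⟨i, _ | _⟩ <;> rcases j with ⟨j, _ | _⟩ <;> simp_all
  have two_notMem : 2 ∉ univ.image v := by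
    simp only [mem_image, mem_univ, true_and, not_exists]
    intro i hi
    have : d + 1 ≤ v i := (Nat.le_mul_of_pos_left _ (Nat.succ_pos _)).trans (v_ge i)
    omega
  have parts_subset (p : n.Partition) (hp : ∀ x ∈ p.parts,
      x % (d + 3) = 2 % (d + 3) ∨ (x + 2) % (d + 3) = 0) :
      p.parts.toFinset ⊆ insert 2 (univ.image v) := by
    intro x hx
    rw [Multiset.mem_toFinset] at hx
    have hxn : x ≤ n := p.parts_sum ▸ Multiset.single_le_sum (by simp) x hx
    have key (i : ℕ) (b : Bool) (h : x = i * (d + 3) + d + 1 + 4 * b.toNat) :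
        x ∈ insert 2 (univ.image v) := by
      have hi : i < N := by
        by_contra! hi
        have : (N + 1) * (d + 1) ≤ (i + 1) * (d + 1) := by gcongr
        nlinarith
      exact mem_insert_of_mem (mem_image.2 ⟨(⟨i, hi⟩, b), mem_univ _, h.symm⟩)
    rcases hp x hx with h | h
    · rw [Nat.mod_eq_of_lt (by omega : 2 < d + 3)] at h
      have := Nat.div_add_mod x (d + 3)
      rcases hq : x / (d + 3) with _ | q <;> rw [hq, h] at this
      · simp [← this]
      · exact key q true (by simp; linarith)
    · have hpos := p.parts_pos hx
      have := Nat.div_add_mod (x + 2) (d + 3)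
      rcases hq : (x + 2) / (d + 3) with _ | q <;> rw [hq, h] at this
      · omega
      · exact key q false (by simp; linarith)
  have count_sum (p : n.Partition) (hp : ∀ x ∈ p.parts,
      x % (d + 3) = 2 % (d + 3) ∨ (x + 2) % (d + 3) = 0) :
      p.parts.count 2 * 2 + ∑ i, p.parts.count (v i) * v i = n := by
    rw [← sum_image (f := fun x => p.parts.count x * x) v_inj.injOn,
      ← sum_insert (f := fun x => p.parts.count x * x) two_notMem]
    simpa [p.parts_sum] using (sum_multiset_count_of_subset _ _ (parts_subset p hp)).symm
  let F : {p : n.Partition // ∀ x ∈ p.parts,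
      x % (d + 3) = 2 % (d + 3) ∨ (x + 2) % (d + 3) = 0} → Fin N × Bool → ℕ :=
    fun p i => p.1.parts.count (v i)
  have F_mem (p) : F p ∈ ({c ∈ Fintype.piFinset (fun _ : Fin N × Bool => range (N + 1)) |
      ∑ i, (i.1.val + 1) * c i ≤ N} : Finset _) := by
    have hsum : ∑ i, (i.1.val + 1) * F p i ≤ N := by
      have h1 : (∑ i, (i.1.val + 1) * F p i) * (d + 1) ≤ n := by
        rw [sum_mul]
        refine le_trans (sum_le_sum fun i _ => ?_)
          ((Nat.le_add_left _ _).trans (count_sum p.1 p.2).le)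
        calc (i.1.val + 1) * F p i * (d + 1) = F p i * ((i.1.val + 1) * (d + 1)) := by ring
          _ ≤ F p i * v i := Nat.mul_le_mul_left _ (v_ge i)
      exact Nat.lt_succ_iff.1 (Nat.lt_of_mul_lt_mul_right (h1.trans_lt hn))
    refine mem_filter.2 ⟨Fintype.mem_piFinset.2 fun i => mem_range.2 (Nat.lt_succ_of_le ?_), hsum⟩
    have h1 : (i.1.val + 1) * F p i ≤ N :=
      (single_le_sum (f := fun i : Fin N × Bool => (i.1.val + 1) * F p i)
        (fun _ _ => Nat.zero_le _) (mem_univ i)).trans hsum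
    exact (Nat.le_mul_of_pos_left _ (Nat.succ_pos _)).trans h1
  have F_inj : Function.Injective F := by
    intro p q hpq
    have hcount (i) : p.1.parts.count (v i) = q.1.parts.count (v i) := congrFun hpq i
    apply Subtype.ext
    apply Nat.Partition.ext
    ext x
    by_cases hx : x ∈ insert 2 (univ.image v)
    · rcases mem_insert.1 hx with rfl | hx
      · have h1 := count_sum p.1 p.2
        have h2 := count_sum q.1 q.2
        simp only [hcount] at h1
        omega
      · obtain ⟨i, -, rfl⟩ := mem_image.1 hx
        exact hcount i
    · rw [Multiset.count_eq_zero_of_notMem, Multiset.count_eq_zero_of_notMem]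
      · exact fun h => hx (parts_subset q.1 q.2 (Multiset.mem_toFinset.2 h))
      · exact fun h => hx (parts_subset p.1 p.2 (Multiset.mem_toFinset.2 h))
  rw [QNum, ← Fintype.card_coe, ← Nat.card_eq_fintype_card]
  exact Nat.card_le_card_of_injective (fun p => ⟨F p, F_mem p⟩)
    fun p q h => F_inj (congrArg Subtype.val h)

open Finset in
/-- A Chernoff-type bound for the number of two-coloured partitions of the integers up to `N`. -/
theorem card_multiplicities_mul_pow_le (N : ℕ) {x : ℝ} (hx0 : 0 < x) (hx1 : x < 1) :
    (#{c ∈ Fintype.piFinset (fun _ : Fin N × Bool => range (N + 1)) |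
      ∑ i, (i.1.val + 1) * c i ≤ N} : ℝ) * x ^ N ≤ ∏ i : Fin N, ((1 - x ^ (i.val + 1))⁻¹) ^ 2 := by
  calc _ ≤ ∑ c ∈ Fintype.piFinset (fun _ : Fin N × Bool => range (N + 1)) with
        ∑ i, (i.1.val + 1) * c i ≤ N, ∏ i, (x ^ (i.1.val + 1)) ^ c i := by
        rw [← nsmul_eq_mul]
        refine card_nsmul_le_sum _ _ _ fun c hc => ?_
        simp only [← pow_mul, prod_pow_eq_pow_sum]
        exact pow_le_pow_of_le_one hx0.le hx1.le (mem_filter.1 hc).2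
    _ ≤ ∑ c ∈ Fintype.piFinset (fun _ : Fin N × Bool => range (N + 1)),
        ∏ i, (x ^ (i.1.val + 1)) ^ c i :=
        sum_le_sum_of_subset_of_nonneg (filter_subset _ _) fun _ _ _ => by positivity
    _ = ∏ i : Fin N × Bool, ∑ j ∈ range (N + 1), (x ^ (i.1.val + 1)) ^ j :=
        sum_prod_piFinset _ fun (i : Fin N × Bool) j => (x ^ (i.1.val + 1)) ^ j
    _ ≤ ∏ i : Fin N × Bool, (1 - x ^ (i.1.val + 1))⁻¹ := by
        refine prod_le_prod (fun _ _ => by positivity) fun i _ => ?_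
        have h : x ^ (i.1.val + 1) < 1 := pow_lt_one₀ hx0.le hx1 (Nat.succ_ne_zero _)
        rw [← tsum_geometric_of_lt_one (by positivity) h]
        exact (summable_geometric_of_lt_one (by positivity) h).sum_le_tsum _
          fun _ _ => by positivity
    _ = _ := by
        rw [Fintype.prod_prod_type]
        simp [sq]

open Finset in
/-- A bound for the generating function of partitions inside the unit interval. -/
theorem prod_inv_one_sub_pow_le_exp (N : ℕ) {x : ℝ} (hx0 : 0 < x) (hx1 : x < 1) :
    ∏ i : Fin N, (1 - x ^ (i.val + 1))⁻¹ ≤ Real.exp (Real.pi ^ 2 / 6 * (x / (1 - x))) := by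
  have hpow (i : ℕ) : x ^ (i + 1) < 1 := pow_lt_one₀ hx0.le hx1 (Nat.succ_ne_zero _)
  have hlog : HasSum (fun k : ℕ => ∑ i : Fin N, (x ^ (i.val + 1)) ^ (k + 1) / ((k : ℝ) + 1))
      (∑ i : Fin N, -Real.log (1 - x ^ (i.val + 1))) :=
    hasSum_sum fun i _ => Real.hasSum_pow_div_log_of_abs_lt_one
      (by rw [abs_of_pos (by positivity)]; exact hpow i)
  have hzeta : HasSum (fun k : ℕ => 1 / ((k : ℝ) + 1) ^ 2 * (x / (1 - x)))
      (Real.pi ^ 2 / 6 * (x / (1 - x))) := by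
    refine HasSum.mul_right _ ?_
    have := (hasSum_nat_add_iff' 1).2 hasSum_zeta_two
    simpa using this
  have hle : ∑ i : Fin N, -Real.log (1 - x ^ (i.val + 1)) ≤
      Real.pi ^ 2 / 6 * (x / (1 - x)) := by
    refine hasSum_le (fun k => ?_) hlog hzeta
    have h1x : 0 < 1 - x := sub_pos.2 hx1
    have hk : 0 < 1 - x ^ (k + 1) := sub_pos.2 (hpow k)
    have hgeom : ((k : ℝ) + 1) * x ^ k * (1 - x) ≤ 1 - x ^ (k + 1) := by
      rw [← geom_sum_mul_neg]
      gcongr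
      calc ((k : ℝ) + 1) * x ^ k = ∑ _i ∈ range (k + 1), x ^ k := by simp
        _ ≤ _ := sum_le_sum fun i hi => pow_le_pow_of_le_one hx0.le hx1.le
          (Nat.lt_succ_iff.1 (mem_range.1 hi))
    calc ∑ i : Fin N, (x ^ (i.val + 1)) ^ (k + 1) / ((k : ℝ) + 1)
        = x ^ (k + 1) * (∑ i ∈ range N, (x ^ (k + 1)) ^ i) / (k + 1) := by
          rw [← Fin.sum_univ_eq_sum_range, ← sum_div, mul_sum]
          congr 1
          exact sum_congr rfl fun i _ => by ring
      _ ≤ x ^ (k + 1) * (1 - x ^ (k + 1))⁻¹ / (k + 1) := by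
          gcongr
          rw [← tsum_geometric_of_lt_one (by positivity) (hpow k)]
          exact (summable_geometric_of_lt_one (by positivity) (hpow k)).sum_le_tsum _
            fun _ _ => by positivity
      _ ≤ x ^ (k + 1) * (((k : ℝ) + 1) * x ^ k * (1 - x))⁻¹ / (k + 1) := by gcongr
      _ = 1 / ((k : ℝ) + 1) ^ 2 * (x / (1 - x)) := by
          field_simp
          rw [pow_succ]
  have hinv (i : Fin N) : 0 < (1 - x ^ (i.val + 1))⁻¹ := inv_pos.2 (sub_pos.2 (hpow i))
  rw [← Real.log_le_iff_le_exp (prod_pos fun i _ => hinv i),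
    Real.log_prod fun i _ => (hinv i).ne']
  simpa [Real.log_inv] using hle

/-- Distinct lists of numbers at least `2` with gaps at least `d` yield distinct partitions. -/
theorem card_le_qNum_two {d n : ℕ} (hd : 1 ≤ d) (S : Finset (List ℕ))
    (hS : ∀ l ∈ S, (∀ x ∈ l, 2 ≤ x) ∧ l.Pairwise (fun x y => x + d ≤ y) ∧ l.sum = n) :
    S.card ≤ qNum 2 d n := by
  rw [qNum, ← Fintype.card_coe, ← Nat.card_eq_fintype_card]
  refine Nat.card_le_card_of_injective
    (fun l => ⟨⟨(l.1 : Multiset ℕ), fun {i} hi => ?_, ?_⟩, ?_, l.1, rfl, ?_⟩) ?_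
  · exact two_pos.trans_le ((hS l.1 l.2).1 i (by simpa using hi))
  · simpa using (hS l.1 l.2).2.2
  · simpa using (hS l.1 l.2).1
  · exact (hS l.1 l.2).2.1.imp fun {x y} h => by omega
  · intro l m h
    simp only [Subtype.mk.injEq, Nat.Partition.mk.injEq, Multiset.coe_eq_coe] at h
    have sorted (l : S) : l.1.Pairwise (fun x y => x ≤ y) :=
      (hS l.1 l.2).2.1.imp fun {x y} h => by omega
    exact Subtype.ext (h.eq_of_pairwise' (sorted l) (sorted m))

open Finset in
/-- Choosing all but the largest part freely in `r` separate windows of length `w + 1` bounds the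
number of partitions with gaps at least `d` from below. -/
theorem pow_le_qNum_two_s12 {d n r w : ℕ} (hd : 1 ≤ d)
    (h : 4 * (r + 1) + d * (r * (r + 1)) + w * (r * (r + 3)) ≤ 2 * n) :
    (w + 1) ^ r ≤ qNum 2 d n := by
  let a : (Fin r → Fin (w + 1)) → Fin r → ℕ := fun u i => 2 + i * (d + w) + u i
  let L : (Fin r → Fin (w + 1)) → List ℕ := fun u => List.ofFn (a u) ++ [n - ∑ i, a u i]
  have L_inj : Function.Injective L := by
    intro u v huv
    have := List.ofFn_injective (List.append_inj_left huv (by simp))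
    ext i
    simpa [a] using congrFun this i
  have hsum (u) (i : Fin r) : ∑ i, a u i + (a u i + d) ≤ n := by
    have h1 : ∑ i, a u i ≤ ∑ i ∈ range r, (2 + i * (d + w) + w) := by
      rw [← Fin.sum_univ_eq_sum_range]
      exact sum_le_sum fun i _ => Nat.add_le_add_left (Nat.lt_succ_iff.1 (u i).2) _
    have h2 : 2 * ∑ i ∈ range r, (2 + i * (d + w) + w) =
        r * 4 + r * (r - 1) * (d + w) + 2 * r * w := by
      rw [← Finset.sum_range_id_mul_two]
      simp only [sum_add_distrib, ← sum_mul]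
      simp
      ring
    have h3 : a u i ≤ 2 + (r - 1) * (d + w) + w := by
      have h4 : (i : ℕ) ≤ r - 1 := by omega
      have h5 : (u i : ℕ) ≤ w := by omega
      simp only [a]
      gcongr
    obtain ⟨s, rfl⟩ : ∃ s, r = s + 1 := ⟨r - 1, by have := i.2; omega⟩
    simp only [Nat.add_sub_cancel] at h2 h3
    nlinarith
  have hsum' (u) : ∑ i, a u i + 2 ≤ n := by
    rcases r with _ | r
    · simp at h ⊢; omega
    · have := hsum u 0
      have : 2 ≤ a u 0 := by simp [a]
      omega
  calc (w + 1) ^ r = (univ.map ⟨L, L_inj⟩).card := by simp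
    _ ≤ _ := card_le_qNum_two hd _ fun l hl => by
      obtain ⟨u, -, rfl⟩ := mem_map.1 hl
      refine ⟨?_, ?_, ?_⟩
      · simp only [Function.Embedding.coeFn_mk, L, List.mem_append, List.mem_ofFn,
          List.mem_singleton]
        rintro x (⟨i, rfl⟩ | rfl)
        · simp only [a]; omega
        · have := hsum' u; omega
      · simp only [Function.Embedding.coeFn_mk, L, List.pairwise_append, List.pairwise_ofFn]
        refine ⟨fun i j hij => ?_, by simp, ?_⟩
        · have h1 : (i.val + 1) * (d + w) ≤ j * (d + w) := Nat.mul_le_mul_right _ hij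
          have h2 := (u i).2
          simp only [a]
          linarith
        · simp only [List.mem_ofFn, List.mem_singleton]
          rintro _ ⟨i, rfl⟩ _ rfl
          have := hsum u i
          omega
      · have := hsum' u
        simp only [Function.Embedding.coeFn_mk, L, List.sum_append, List.sum_ofFn,
          List.sum_singleton]
        omega

/-- Below `2 * (d + 1)` there are at most three such partitions, since all parts but one are `2`. -/
theorem QNum_two_le_three {d n : ℕ} (hd : 2 ≤ d) (hn : n < 2 * (d + 1)) : QNum 2 d n ≤ 3 :=
  (QNum_two_le_card_multiplicities (N := 1) hd hn).trans (by decide)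

/-- The partitions with parts `n`, with parts `2, n - 2` and with parts `3, n - 3`. -/
theorem three_le_qNum_two {d n : ℕ} (hd : 2 ≤ d) (hn : d + 6 ≤ n) : 3 ≤ qNum 2 d n := by
  have h := card_le_qNum_two (d := d) (n := n) (by omega) {[n], [2, n - 2], [3, n - 3]} (by
    simp only [Finset.mem_insert, Finset.mem_singleton]
    rintro l (rfl | rfl | rfl) <;> simp <;> omega)
  rwa [Finset.card_eq_three.2 ⟨[n], [2, n - 2], [3, n - 3], by simp, by simp, by simp, rfl⟩] at h

/-- An upper bound for `QNum 2` and the window bound for `qNum 2` combine to compare the two. -/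
theorem QNum_two_le_qNum_two_of_bounds {d n N r w : ℕ} (hd : 254 ≤ d)
    (hn₁ : N * (d + 1) ≤ n) (hn₂ : n < (N + 1) * (d + 1)) (hr : r * (r + 1) ≤ 2 * N)
    (hw : 4 * (r + 1) + 254 * (r * (r + 1)) + w * (r * (r + 3)) ≤ 510 * N)
    {x : ℝ} (hx0 : 0 < x) (hx1 : x < 1)
    (h : ∏ i : Fin N, ((1 - x ^ (i.val + 1))⁻¹) ^ 2 ≤ ((w : ℝ) + 1) ^ r * x ^ N) :
    QNum 2 d n ≤ qNum 2 d n := by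
  refine (QNum_two_le_card_multiplicities (by omega) hn₂).trans
    (le_trans ?_ (pow_le_qNum_two_s12 (r := r) (w := w) (by omega) ?_))
  · have := le_of_mul_le_mul_right ((card_multiplicities_mul_pow_le N hx0 hx1).trans h)
      (by positivity)
    exact_mod_cast this
  · obtain ⟨e, rfl⟩ := Nat.exists_eq_add_of_le hd
    nlinarith [Nat.mul_le_mul_left e hr]

/-- The comparison of `QNum 2` and `qNum 2` at the evaluation point `t / (t + 1)`. -/
theorem QNum_two_le_qNum_two_of_exp_le {d n N r w : ℕ} (hd : 254 ≤ d)
    (hn₁ : N * (d + 1) ≤ n) (hn₂ : n < (N + 1) * (d + 1)) (hr : r * (r + 1) ≤ 2 * N)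
    (hw : 4 * (r + 1) + 254 * (r * (r + 1)) + w * (r * (r + 3)) ≤ 510 * N)
    {t : ℝ} (ht : 0 < t)
    (h : (1 + 1 / t) ^ N * Real.exp (3.3 * t) ≤ ((w : ℝ) + 1) ^ r) :
    QNum 2 d n ≤ qNum 2 d n := by
  have hx : (1 + 1 / t)⁻¹ / (1 - (1 + 1 / t)⁻¹) = t := by
    field_simp
    simp
  have hx0 : 0 < (1 + 1 / t)⁻¹ := by positivity
  have hx1 : (1 + 1 / t)⁻¹ < 1 := inv_lt_one_of_one_lt₀ (by simpa using ht)
  refine QNum_two_le_qNum_two_of_bounds hd hn₁ hn₂ hr hw hx0 hx1 ?_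
  have hpi : Real.pi ^ 2 / 6 * t * 2 ≤ 3.3 * t := by
    have := Real.pi_lt_d4
    have := Real.pi_pos
    have : Real.pi ^ 2 ≤ 9.9 := by nlinarith
    nlinarith
  rw [inv_pow, ← div_eq_mul_inv, le_div_iff₀ (by positivity)]
  refine le_trans ?_ h
  rw [mul_comm, Finset.prod_pow]
  gcongr
  calc _ ≤ Real.exp (Real.pi ^ 2 / 6 * t) ^ 2 := by
        gcongr
        · exact Finset.prod_nonneg fun i _ =>
            inv_nonneg.2 (sub_nonneg.2 (pow_le_one₀ hx0.le hx1.le))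
        · exact (prod_inv_one_sub_pow_le_exp N hx0 hx1).trans_eq (by rw [hx])
    _ = Real.exp (Real.pi ^ 2 / 6 * t * 2) := by rw [← Real.exp_nat_mul]; push_cast; ring_nf
    _ ≤ _ := Real.exp_le_exp.2 hpi

theorem three_halves_pow_mul_exp_le {N M : ℕ} (hN : N ≤ M) {B : ℝ} (h : 1.5 ^ M * 736 ≤ B) :
    (1 + 1 / 2 : ℝ) ^ N * Real.exp (3.3 * 2) ≤ B := by
  have hexp : Real.exp (3.3 * 2) ≤ 736 := by
    refine le_of_pow_le_pow_left₀ (n := 5) (by norm_num) (by norm_num) ?_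
    rw [← Real.exp_nat_mul, show ((5 : ℕ) : ℝ) * (3.3 * 2) = (33 : ℕ) * 1 by norm_num,
      Real.exp_nat_mul]
    calc Real.exp 1 ^ 33 ≤ 2.7182818286 ^ 33 := by gcongr; exact Real.exp_one_lt_d9.le
      _ ≤ 736 ^ 5 := by norm_num
  calc (1 + 1 / 2 : ℝ) ^ N * Real.exp (3.3 * 2) ≤ (1.5 : ℝ) ^ M * 736 := by
        rw [show (1 + 1 / 2 : ℝ) = 1.5 by norm_num]
        gcongr
        norm_num
    _ ≤ B := h

theorem one_add_two_div_pow_mul_exp_le {N k : ℕ} (hk : 6 ≤ k) (hN : N ≤ k ^ 2 + 2 * k) :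
    (1 + 1 / ((k : ℝ) / 2)) ^ N * Real.exp (3.3 * (k / 2)) ≤ 255 ^ (k - 1) := by
  have hk0 : (0 : ℝ) < k := by positivity
  have hN' : (N : ℝ) ≤ k ^ 2 + 2 * k := by exact_mod_cast hN
  have hexp : Real.exp 5.5 ≤ 255 := by
    refine le_of_pow_le_pow_left₀ (n := 2) (by norm_num) (by norm_num) ?_
    rw [← Real.exp_nat_mul, show ((2 : ℕ) : ℝ) * 5.5 = (11 : ℕ) * 1 by norm_num,
      Real.exp_nat_mul]
    calc Real.exp 1 ^ 11 ≤ 2.7182818286 ^ 11 := by gcongr; exact Real.exp_one_lt_d9.le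
      _ ≤ 255 ^ 2 := by norm_num
  calc (1 + 1 / ((k : ℝ) / 2)) ^ N * Real.exp (3.3 * (k / 2))
      ≤ Real.exp (2 / k) ^ N * Real.exp (3.3 * (k / 2)) := by
        gcongr
        rw [one_div_div, add_comm]
        exact Real.add_one_le_exp _
    _ = Real.exp (N * (2 / k) + 3.3 * (k / 2)) := by rw [Real.exp_add, Real.exp_nat_mul]
    _ ≤ Real.exp ((k - 1 : ℕ) * 5.5) := by
        rw [Real.exp_le_exp]
        have h1 : (N : ℝ) * (2 / k) ≤ 2 * k + 4 := by
          rw [← mul_div_assoc, div_le_iff₀ hk0]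
          nlinarith
        have h2 : (6 : ℝ) ≤ k := by exact_mod_cast hk
        rw [Nat.cast_sub (by omega)]
        push_cast
        linarith
    _ = Real.exp 5.5 ^ (k - 1) := Real.exp_nat_mul _ _
    _ ≤ 255 ^ (k - 1) := by gcongr

theorem alder_two_even_generic (d n : ℕ) (hd : 254 ≤ d) (hde : Even d)
    (hpow : ∀ r : ℕ, d ≠ 2 ^ r - 2) (hn : d + 7 ≤ n) :
    QNum 2 d n ≤ qNum 2 d n := by
  obtain ⟨N, hN⟩ : ∃ N, N = n / (d + 1) := ⟨_, rfl⟩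
  have hn₁ : N * (d + 1) ≤ n := hN ▸ Nat.div_mul_le_self _ _
  have hn₂ : n < (N + 1) * (d + 1) := by
    rw [hN, mul_comm]; exact Nat.lt_mul_div_succ _ (Nat.succ_pos _)
  have hN₁ : 1 ≤ N := hN ▸ (Nat.le_div_iff_mul_le (Nat.succ_pos _)).2 (by omega)
  have of_small (M r w : ℕ) (hNM : N ≤ M) (hr : r * (r + 1) ≤ 2 * N)
      (hw : 4 * (r + 1) + 254 * (r * (r + 1)) + w * (r * (r + 3)) ≤ 510 * N)
      (h : (1.5 : ℝ) ^ M * 736 ≤ ((w : ℝ) + 1) ^ r) : QNum 2 d n ≤ qNum 2 d n :=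
    QNum_two_le_qNum_two_of_exp_le hd hn₁ hn₂ hr hw two_pos (three_halves_pow_mul_exp_le hNM h)
  rcases lt_or_ge N 6 with hN₆ | hN₆
  · have of_tiny (w : ℕ) (hN₂ : 2 ≤ N) (hw : 516 + 4 * w ≤ 510 * N)
        (h : ∏ i : Fin N, ((1 - (1 / 2 : ℝ) ^ (i.val + 1))⁻¹) ^ 2 ≤
          ((w : ℝ) + 1) ^ 1 * (1 / 2) ^ N) : QNum 2 d n ≤ qNum 2 d n :=
      QNum_two_le_qNum_two_of_bounds hd hn₁ hn₂ (by omega) (by omega) (by norm_num)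
        (by norm_num) h
    clear hN of_small
    interval_cases N
    · exact (QNum_two_le_three (by omega) hn₂).trans (three_le_qNum_two (by omega) (by omega))
    · exact of_tiny 126 (by norm_num) (by norm_num) (by norm_num [Fin.prod_univ_succ])
    · exact of_tiny 253 (by norm_num) (by norm_num) (by norm_num [Fin.prod_univ_succ])
    · exact of_tiny 381 (by norm_num) (by norm_num) (by norm_num [Fin.prod_univ_succ])
    · exact of_tiny 508 (by norm_num) (by norm_num) (by norm_num [Fin.prod_univ_succ])
  rcases lt_or_ge N 8 with hN₈ | hN₈
  · exact of_small 7 2 152 (by omega) (by omega) (by omega) (by norm_num)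
  rcases lt_or_ge N 12 with hN₁₂ | hN₁₂
  · exact of_small 11 2 254 (by omega) (by omega) (by omega) (by norm_num)
  rcases lt_or_ge N 22 with hN₂₂ | hN₂₂
  · exact of_small 21 3 169 (by omega) (by omega) (by omega) (by norm_num)
  rcases lt_or_ge N 36 with hN₃₆ | hN₃₆
  · exact of_small 35 4 218 (by omega) (by omega) (by omega) (by norm_num)
  · obtain ⟨k, hk⟩ : ∃ k, k = N.sqrt := ⟨_, rfl⟩
    have hk₁ : k ^ 2 ≤ N := hk ▸ Nat.sqrt_le' N
    have hk₂ : N < (k + 1) ^ 2 := hk ▸ Nat.lt_succ_sqrt' N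
    have hk₆ : 6 ≤ k := by nlinarith
    refine QNum_two_le_qNum_two_of_exp_le (r := k - 1) (w := 254) hd hn₁ hn₂ ?_ ?_
      (t := (k : ℝ) / 2) (by positivity) ?_
    · obtain ⟨s, rfl⟩ : ∃ s, k = s + 1 := ⟨k - 1, by omega⟩
      simp only [Nat.add_sub_cancel]
      nlinarith
    · obtain ⟨s, rfl⟩ : ∃ s, k = s + 1 := ⟨k - 1, by omega⟩
      simp only [Nat.add_sub_cancel]
      nlinarith
    · have := one_add_two_div_pow_mul_exp_le hk₆ (N := N) (by linarith)
      norm_num at this ⊢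
      exact this
end
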